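/- arXiv:2507.16399 — 3 statements merged into one kernel-verified Lean document; each statement's English description precedes it below -/
import Mathlib

section
/- Let m ≥ 2 and let f be an m×2 positive definite biquadratic form, i.e., f(x, y) > 0 whenever x ∈ ℝ^m, y ∈ ℝ², x ≠ 0 and y ≠ 0. Then there exists an (m−1)×1×1 degenerated tripartite quartic form h such that h is a sum of finitely many squares of quadratic forms on ℝ^{m−1} × ℝ × ℝ, and such that whenever h is a sum of K squares of quadratic forms, f is a sum of K+1 squares of bilinear forms; in particular the sos rank of f is at most the sos rank of h plus one. -/
/-- A bilinear form on ℝ^m × ℝ^n. -/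
def IsBilinearForm (m n : ℕ) (b : (Fin m → ℝ) → (Fin n → ℝ) → ℝ) : Prop :=
  ∃ c : Fin m → Fin n → ℝ, ∀ x y, b x y = ∑ i, ∑ k, c i k * x i * y k

/-- `f` is a sum of `K` squares of bilinear forms. -/
def IsSumSqBilinear (m n K : ℕ) (f : (Fin m → ℝ) → (Fin n → ℝ) → ℝ) : Prop :=
  ∃ b : Fin K → (Fin m → ℝ) → (Fin n → ℝ) → ℝ,
    (∀ k, IsBilinearForm m n (b k)) ∧ ∀ x y, f x y = ∑ k, (b k x y) ^ 2

/-- An (m)×1×1 degenerated tripartite quartic form: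
`h(x,y,z) = h₂(x)z² + h₃(x)yz + h₄(x)y² + h₅(x)yz² + h₆(x)y²z + h₇y²z²`, where
`h₂, h₃, h₄` are quadratic forms on ℝ^m, `h₅, h₆` are linear forms, `h₇ ∈ ℝ`. -/
def IsDeg111TripartiteQuartic (m : ℕ) (h : (Fin m → ℝ) → ℝ → ℝ → ℝ) : Prop :=
  ∃ (A B C : Fin m → Fin m → ℝ) (p q : Fin m → ℝ) (c : ℝ),
    ∀ x y z, h x y z =
      (∑ i, ∑ j, A i j * x i * x j) * z ^ 2
        + (∑ i, ∑ j, B i j * x i * x j) * (y * z)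
        + (∑ i, ∑ j, C i j * x i * x j) * y ^ 2
        + (∑ i, p i * x i) * (y * z ^ 2)
        + (∑ i, q i * x i) * (y ^ 2 * z)
        + c * (y ^ 2 * z ^ 2)

/-- A quadratic form on ℝ^m × ℝ × ℝ in the combined variables (x, y, z). -/
def IsQuadFormXYZ1 (m : ℕ) (q : (Fin m → ℝ) → ℝ → ℝ → ℝ) : Prop :=
  ∃ (A : Fin m → Fin m → ℝ) (b c : Fin m → ℝ) (d e f : ℝ),
    ∀ x y z, q x y z =
      (∑ i, ∑ j, A i j * x i * x j) + (∑ i, b i * x i) * y + (∑ i, c i * x i) * z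
        + d * y ^ 2 + e * (y * z) + f * z ^ 2

/-- `h` is a sum of `K` squares of quadratic forms on ℝ^m × ℝ × ℝ. -/
def IsSumSqQuadXYZ1 (m K : ℕ) (h : (Fin m → ℝ) → ℝ → ℝ → ℝ) : Prop :=
  ∃ q : Fin K → (Fin m → ℝ) → ℝ → ℝ → ℝ,
    (∀ k, IsQuadFormXYZ1 m (q k)) ∧ ∀ x y z, h x y z = ∑ k, (q k x y z) ^ 2

open Matrix in
open scoped MatrixOrder in
theorem Matrix.PosDef.exists_simultaneous_diagonalization {n : Type*} [Fintype n] [DecidableEq n]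
    {P S : Matrix n n ℝ} (hP : P.PosDef) (hS : Sᵀ = S) :
    ∃ (T : Matrix n n ℝ) (d : n → ℝ), IsUnit T ∧ P = T * Tᵀ ∧ S = T * diagonal d * Tᵀ := by
  obtain ⟨B, hB⟩ := CStarAlgebra.nonneg_iff_eq_star_mul_self.mp hP.posSemidef.nonneg
  have hBu : IsUnit B := by
    have h := hP.isUnit
    rw [hB, Matrix.isUnit_iff_isUnit_det, det_mul] at h
    exact (Matrix.isUnit_iff_isUnit_det _).2 (isUnit_of_mul_isUnit_right h)
  have hB' : P = Bᵀ * B := by simpa [star_eq_conjTranspose] using hB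
  have hdet : IsUnit B.det := (Matrix.isUnit_iff_isUnit_det _).1 hBu
  have hdet' : IsUnit Bᵀ.det := by rwa [det_transpose]
  have hH : (B⁻¹ᵀ * S * B⁻¹).IsHermitian := by
    simp [IsHermitian, conjTranspose_eq_transpose_of_trivial, transpose_mul, hS, Matrix.mul_assoc]
  obtain ⟨U, d, hU, hUd⟩ : ∃ (U : Matrix n n ℝ) (d : n → ℝ), U * Uᵀ = 1 ∧
      B⁻¹ᵀ * S * B⁻¹ = U * diagonal d * Uᵀ := by
    refine ⟨hH.eigenvectorUnitary, hH.eigenvalues, ?_, ?_⟩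
    · have := Unitary.coe_mul_star_self hH.eigenvectorUnitary
      simpa [star_eq_conjTranspose] using this
    · have := hH.spectral_theorem
      rw [Unitary.conjStarAlgAut_apply] at this
      simpa [star_eq_conjTranspose] using this
  have h1 : Bᵀ * B⁻¹ᵀ = 1 := by rw [← transpose_mul, nonsing_inv_mul _ hdet, transpose_one]
  have h2 : B⁻¹ * B = 1 := nonsing_inv_mul _ hdet
  refine ⟨Bᵀ * U, d, ?_, ?_, ?_⟩
  · exact ((Matrix.isUnit_iff_isUnit_det _).2 hdet').mul (IsUnit.of_mul_eq_one _ hU)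
  · rw [transpose_mul, transpose_transpose, Matrix.mul_assoc, ← Matrix.mul_assoc U, hU,
      Matrix.one_mul, hB']
  · calc S = (Bᵀ * B⁻¹ᵀ) * S * (B⁻¹ * B) := by rw [h1, h2, Matrix.one_mul, Matrix.mul_one]
      _ = Bᵀ * (B⁻¹ᵀ * S * B⁻¹) * B := by simp only [Matrix.mul_assoc]
      _ = _ := by rw [hUd, transpose_mul, transpose_transpose]; simp only [Matrix.mul_assoc]

open Matrix in
theorem Matrix.PosSemidef.trace_mul_nonneg_of_quadratic_nonneg {n : Type*} [Fintype n]
    {P C : Matrix n n ℝ} (hP : P.PosSemidef) (hC : ∀ x, 0 ≤ x ⬝ᵥ C *ᵥ x) :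
    0 ≤ (P * C).trace := by
  obtain ⟨k, v, rfl⟩ := posSemidef_iff_eq_sum_vecMulVec.1 hP
  rw [Finset.sum_mul, trace_sum]
  refine Finset.sum_nonneg fun i _ => ?_
  rw [vecMulVec_mul, trace_vecMulVec, star_trivial, dotProduct_comm, ← dotProduct_mulVec]
  exact hC _

open Matrix in
theorem trace_mul_diagonal_mul_transpose_mul {n : Type*} [Fintype n] [DecidableEq n]
    (T C : Matrix n n ℝ) (d : n → ℝ) :
    (T * diagonal d * Tᵀ * C).trace = ∑ i, d i * (T.col i ⬝ᵥ C *ᵥ T.col i) := by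
  rw [Matrix.mul_assoc, Matrix.mul_assoc, trace_mul_comm, Matrix.mul_assoc, trace]
  refine Finset.sum_congr rfl fun i _ => ?_
  rw [diag_apply, diagonal_mul]
  congr 1
  rw [Matrix.mul_assoc, mul_apply]
  rfl

open Matrix in
theorem trace_pairing_nonneg_of_posDef {n : Type*} [Fintype n] [DecidableEq n]
    {P S R A B C : Matrix n n ℝ} (hP : P.PosDef) (hS : Sᵀ = S)
    (hW : (fromBlocks P S S R).PosSemidef)
    (hg : ∀ (x : n → ℝ) (u v : ℝ),
      0 ≤ u ^ 2 * (x ⬝ᵥ A *ᵥ x) + u * v * (x ⬝ᵥ B *ᵥ x) + v ^ 2 * (x ⬝ᵥ C *ᵥ x)) :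
    0 ≤ (P * A).trace + (S * B).trace + (R * C).trace := by
  obtain ⟨T, d, hT, hPT, hST⟩ := hP.exists_simultaneous_diagonalization hS
  have hdet : IsUnit Tᵀ.det := by
    rw [det_transpose]; exact (Matrix.isUnit_iff_isUnit_det _).1 hT
  have hRt : Rᵀ = R := by
    have h := hW.isHermitian
    rw [isHermitian_fromBlocks_iff] at h
    simpa [IsHermitian] using h.2.2.2
  have hR : (R - T * diagonal (fun i => d i ^ 2) * Tᵀ).PosSemidef := by
    refine .of_dotProduct_mulVec_nonneg ?_ fun x => ?_
    · simp [IsHermitian, transpose_mul, hRt, Matrix.mul_assoc]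
    · have h := hW.dotProduct_mulVec_nonneg
        (Sum.elim (-((Tᵀ)⁻¹ *ᵥ (diagonal d *ᵥ (Tᵀ *ᵥ x)))) x)
      have key : ∀ w, Tᵀ *ᵥ ((Tᵀ)⁻¹ *ᵥ w) = w := fun w => by
        rw [mulVec_mulVec, mul_nonsing_inv _ hdet, one_mulVec]
      set z := (Tᵀ)⁻¹ *ᵥ (diagonal d *ᵥ (Tᵀ *ᵥ x)) with hz
      have hTz : Tᵀ *ᵥ z = diagonal d *ᵥ (Tᵀ *ᵥ x) := key _
      set y := Tᵀ *ᵥ x with hy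
      have e1 : z ⬝ᵥ P *ᵥ z = ∑ i, d i ^ 2 * y i ^ 2 := by
        rw [hPT, ← mulVec_mulVec, dotProduct_mulVec, ← mulVec_transpose, hTz]
        simp [dotProduct, mulVec_diagonal]
        exact Finset.sum_congr rfl fun i _ => by ring
      have e2 : z ⬝ᵥ S *ᵥ x = ∑ i, d i ^ 2 * y i ^ 2 := by
        rw [hST, ← mulVec_mulVec, ← mulVec_mulVec, dotProduct_mulVec, ← mulVec_transpose, hTz]
        simp [dotProduct, mulVec_diagonal, ← hy]
        exact Finset.sum_congr rfl fun i _ => by ring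
      have e3 : x ⬝ᵥ S *ᵥ z = ∑ i, d i ^ 2 * y i ^ 2 := by
        rw [← e2, dotProduct_mulVec, ← mulVec_transpose, hS, dotProduct_comm]
      have e4 : x ⬝ᵥ (T * diagonal (fun i => d i ^ 2) * Tᵀ) *ᵥ x = ∑ i, d i ^ 2 * y i ^ 2 := by
        rw [← mulVec_mulVec, ← mulVec_mulVec, dotProduct_mulVec, ← mulVec_transpose]
        simp [dotProduct, mulVec_diagonal, ← hy]
        exact Finset.sum_congr rfl fun i _ => by ring
      rw [star_trivial, fromBlocks_mulVec, sumElim_dotProduct_sumElim] at h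
      simp only [Sum.elim_comp_inl, Sum.elim_comp_inr, mulVec_neg, dotProduct_add, neg_dotProduct,
        dotProduct_neg, neg_neg, e1, e2, e3] at h
      rw [star_trivial, sub_mulVec, dotProduct_sub, e4]
      linarith
  have hRC := hR.trace_mul_nonneg_of_quadratic_nonneg (C := C) fun x => by
    simpa using hg x 0 1
  rw [Matrix.sub_mul, trace_sub, trace_mul_diagonal_mul_transpose_mul] at hRC
  have hPA : (P * A).trace = ∑ i, 1 * (T.col i ⬝ᵥ A *ᵥ T.col i) := by
    rw [← trace_mul_diagonal_mul_transpose_mul, hPT]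
    simp
  have hSB : (S * B).trace = ∑ i, d i * (T.col i ⬝ᵥ B *ᵥ T.col i) := by
    rw [← trace_mul_diagonal_mul_transpose_mul, hST]
  have hsum : 0 ≤ ∑ i, (1 * (T.col i ⬝ᵥ A *ᵥ T.col i) + d i * (T.col i ⬝ᵥ B *ᵥ T.col i) +
      d i ^ 2 * (T.col i ⬝ᵥ C *ᵥ T.col i)) :=
    Finset.sum_nonneg fun i _ => by simpa using hg (T.col i) 1 (d i)
  rw [Finset.sum_add_distrib, Finset.sum_add_distrib] at hsum
  linarith

open Matrix in
theorem trace_pairing_nonneg {n : Type*} [Fintype n] [DecidableEq n]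
    {P S R A B C : Matrix n n ℝ} (hS : Sᵀ = S)
    (hW : (fromBlocks P S S R).PosSemidef)
    (hg : ∀ (x : n → ℝ) (u v : ℝ),
      0 ≤ u ^ 2 * (x ⬝ᵥ A *ᵥ x) + u * v * (x ⬝ᵥ B *ᵥ x) + v ^ 2 * (x ⬝ᵥ C *ᵥ x)) :
    0 ≤ (P * A).trace + (S * B).trace + (R * C).trace := by
  have hP : P.PosSemidef := hW.submatrix Sum.inl
  have key : ∀ ε : ℝ, 0 < ε →
      0 ≤ (P * A).trace + (S * B).trace + (R * C).trace + ε * A.trace := by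
    intro ε hε
    have hE : (ε • (1 : Matrix n n ℝ)).PosDef := PosDef.one.smul hε
    have h0 : (fromBlocks (ε • (1 : Matrix n n ℝ)) 0 0 (0 : Matrix n n ℝ)).PosSemidef := by
      refine .of_dotProduct_mulVec_nonneg ?_ fun x => ?_
      · exact isHermitian_fromBlocks_iff.2 ⟨hE.isHermitian, by simp, by simp, isHermitian_zero⟩
      · rw [star_trivial, fromBlocks_mulVec, ← Sum.elim_comp_inl_inr x, sumElim_dotProduct_sumElim]
        simpa using hE.posSemidef.dotProduct_mulVec_nonneg (x ∘ Sum.inl)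
    have h := trace_pairing_nonneg_of_posDef (P := P + ε • 1) (R := R)
      (PosDef.posSemidef_add hP hE) hS
      (by simpa [fromBlocks_add] using hW.add h0) hg
    simp only [Matrix.add_mul, trace_add, smul_mul, Matrix.one_mul, trace_smul, smul_eq_mul] at h
    linarith
  have hlim : Filter.Tendsto
      (fun ε : ℝ => (P * A).trace + (S * B).trace + (R * C).trace + ε * A.trace)
      (nhdsWithin 0 (Set.Ioi 0)) (nhds ((P * A).trace + (S * B).trace + (R * C).trace)) := by
    refine Filter.Tendsto.mono_left ?_ nhdsWithin_le_nhds
    have : Continuous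
        (fun ε : ℝ => (P * A).trace + (S * B).trace + (R * C).trace + ε * A.trace) := by
      fun_prop
    simpa using this.tendsto 0
  exact ge_of_tendsto hlim (Filter.eventually_of_mem self_mem_nhdsWithin key)

open Matrix in
theorem exists_pos_mul_le_of_biquadratic_pos {n : Type*} [Fintype n] {A B C : Matrix n n ℝ}
    (hg : ∀ (x : n → ℝ) (u v : ℝ), x ≠ 0 → (u, v) ≠ (0, 0) →
      0 < u ^ 2 * (x ⬝ᵥ A *ᵥ x) + u * v * (x ⬝ᵥ B *ᵥ x) + v ^ 2 * (x ⬝ᵥ C *ᵥ x)) :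
    ∃ δ > 0, ∀ (x : n → ℝ) (u v : ℝ), δ * ((u ^ 2 + v ^ 2) * (x ⬝ᵥ x)) ≤
      u ^ 2 * (x ⬝ᵥ A *ᵥ x) + u * v * (x ⬝ᵥ B *ᵥ x) + v ^ 2 * (x ⬝ᵥ C *ᵥ x) := by
  have hpos : ∀ (x : n → ℝ) (u v : ℝ), x ≠ 0 → (u, v) ≠ (0, 0) →
      0 < (u ^ 2 + v ^ 2) * (x ⬝ᵥ x) := by
    intro x u v hx huv
    have h1 : 0 < x ⬝ᵥ x := by simpa using dotProduct_self_star_pos_iff.2 hx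
    have h2 : 0 < u ^ 2 + v ^ 2 := by
      by_contra h
      apply huv
      have hu : u = 0 := by nlinarith [sq_nonneg u, sq_nonneg v]
      have hv : v = 0 := by nlinarith [sq_nonneg u, sq_nonneg v]
      rw [hu, hv]
    positivity
  let F : (n → ℝ) × (ℝ × ℝ) → ℝ := fun p =>
    (p.2.1 ^ 2 * (p.1 ⬝ᵥ A *ᵥ p.1) + p.2.1 * p.2.2 * (p.1 ⬝ᵥ B *ᵥ p.1) +
      p.2.2 ^ 2 * (p.1 ⬝ᵥ C *ᵥ p.1)) / ((p.2.1 ^ 2 + p.2.2 ^ 2) * (p.1 ⬝ᵥ p.1))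
  let K : Set ((n → ℝ) × (ℝ × ℝ)) := Metric.sphere 0 1 ×ˢ Metric.sphere 0 1
  have hK : IsCompact K := (isCompact_sphere _ _).prod (isCompact_sphere _ _)
  have hne : ∀ p ∈ K, p.1 ≠ 0 ∧ (p.2.1, p.2.2) ≠ (0, 0) := by
    rintro ⟨x, u, v⟩ ⟨hx, huv⟩
    exact ⟨ne_zero_of_mem_unit_sphere ⟨x, hx⟩, ne_zero_of_mem_unit_sphere ⟨(u, v), huv⟩⟩
  have hF : ContinuousOn F K := by
    refine ContinuousOn.div (by fun_prop) (by fun_prop) fun p hp => ?_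
    exact (hpos _ _ _ (hne p hp).1 (hne p hp).2).ne'
  obtain ⟨δ, hδ, hmin⟩ := hK.exists_forall_le' hF (a := 0) fun p hp =>
    div_pos (hg _ _ _ (hne p hp).1 (hne p hp).2) (hpos _ _ _ (hne p hp).1 (hne p hp).2)
  refine ⟨δ, hδ, fun x u v => ?_⟩
  by_cases hx : x = 0
  · simp [hx]
  by_cases huv : (u, v) = (0, 0)
  · obtain ⟨rfl, rfl⟩ := Prod.mk.inj huv
    simp
  have hxn : ‖x‖ ≠ 0 := norm_ne_zero_iff.2 hx
  have hyn : ‖(u, v)‖ ≠ 0 := norm_ne_zero_iff.2 huv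
  have hmem : (‖x‖⁻¹ • x, ‖(u, v)‖⁻¹ • (u, v)) ∈ K := by
    constructor <;> simp only [mem_sphere_zero_iff_norm, norm_smul, norm_inv, norm_norm]
    · exact inv_mul_cancel₀ hxn
    · exact inv_mul_cancel₀ hyn
  have h := hmin _ hmem
  rw [le_div_iff₀ (hpos _ _ _ (hne _ hmem).1 (hne _ hmem).2)] at h
  simp only [Prod.smul_fst, Prod.smul_snd, smul_eq_mul, mulVec_smul, dotProduct_smul,
    smul_dotProduct] at h
  have hc : 0 < (‖x‖⁻¹ * ‖(u, v)‖⁻¹) ^ 2 := by positivity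
  refine le_of_mul_le_mul_left ?_ hc
  linarith

open Matrix in
theorem isOpen_setOf_quadratic_pos (n : Type*) [Fintype n] :
    IsOpen {M : Matrix n n ℝ | ∀ w, w ≠ 0 → 0 < w ⬝ᵥ M *ᵥ w} := by
  have hset : {M : Matrix n n ℝ | ∀ w, w ≠ 0 → 0 < w ⬝ᵥ M *ᵥ w} =
      {M : Matrix n n ℝ | ∀ w ∈ Metric.sphere (0 : n → ℝ) 1, 0 < w ⬝ᵥ M *ᵥ w} := by
    ext M
    refine ⟨fun h w hw => h w (ne_zero_of_mem_unit_sphere ⟨w, hw⟩), fun h w hw => ?_⟩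
    have hn : ‖w‖ ≠ 0 := norm_ne_zero_iff.2 hw
    have h1 := h (‖w‖⁻¹ • w) (by
      simp only [mem_sphere_zero_iff_norm, norm_smul, norm_inv, norm_norm]
      exact inv_mul_cancel₀ hn)
    simp only [mulVec_smul, dotProduct_smul, smul_dotProduct, smul_eq_mul] at h1
    have hc : 0 < ‖w‖⁻¹ := by positivity
    exact pos_of_mul_pos_right (pos_of_mul_pos_right h1 hc.le) hc.le
  rw [hset, isOpen_iff_eventually]
  intro M hM
  refine (isCompact_sphere _ _).eventually_forall_of_forall_eventually fun w hw => ?_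
  have hcont : Continuous fun z : Matrix n n ℝ × (n → ℝ) => z.2 ⬝ᵥ z.1 *ᵥ z.2 := by fun_prop
  exact hcont.continuousAt.eventually (lt_mem_nhds (hM w hw))

open Matrix in
theorem Matrix.exists_trace_mul_eq {n : Type*} [Fintype n] [DecidableEq n]
    (L : Matrix n n ℝ →ₗ[ℝ] ℝ) : ∃ W : Matrix n n ℝ, ∀ M, L M = (W * M).trace := by
  refine ⟨of fun j i => L (single i j 1), fun M => ?_⟩
  conv_lhs => rw [matrix_eq_sum_single M]
  simp only [map_sum, trace, diag_apply, mul_apply, of_apply]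
  rw [Finset.sum_comm]
  refine Finset.sum_congr rfl fun i _ => Finset.sum_congr rfl fun j _ => ?_
  rw [show single j i (M j i) = M j i • single j i (1 : ℝ) by simp [smul_single], map_smul,
    smul_eq_mul, mul_comm]

open Matrix in
theorem Matrix.trace_fromBlocks_eq_add {n : Type*} [Fintype n] (A B C D : Matrix n n ℝ) :
    (fromBlocks A B C D).trace = A.trace + D.trace := by
  simp [trace, Fintype.sum_sum_type]

open Matrix in
theorem exists_posDef_gram_of_biquadratic_pos {n : Type*} [Fintype n] [DecidableEq n]
    {A B C : Matrix n n ℝ} (hA : Aᵀ = A) (hB : Bᵀ = B) (hC : Cᵀ = C)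
    (hg : ∀ (x : n → ℝ) (u v : ℝ), x ≠ 0 → (u, v) ≠ (0, 0) →
      0 < u ^ 2 * (x ⬝ᵥ A *ᵥ x) + u * v * (x ⬝ᵥ B *ᵥ x) + v ^ 2 * (x ⬝ᵥ C *ᵥ x)) :
    ∃ N : Matrix n n ℝ, Nᵀ = -N ∧
      (fromBlocks A ((1 / 2 : ℝ) • B + N) ((1 / 2 : ℝ) • B - N) C).PosDef := by
  let G : Matrix n n ℝ → Matrix (n ⊕ n) (n ⊕ n) ℝ := fun N =>
    fromBlocks A ((1 / 2 : ℝ) • B + N) ((1 / 2 : ℝ) • B - N) C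
  let U : Set (Matrix (n ⊕ n) (n ⊕ n) ℝ) := {M | ∀ w, w ≠ 0 → 0 < w ⬝ᵥ M *ᵥ w}
  let F : Set (Matrix (n ⊕ n) (n ⊕ n) ℝ) := {M | ∃ N : Matrix n n ℝ, Nᵀ = -N ∧ M = G N}
  by_contra hcon
  have hGH : ∀ N : Matrix n n ℝ, Nᵀ = -N → (G N).IsHermitian := by
    intro N hN
    refine isHermitian_fromBlocks_iff.2 ⟨?_, ?_, ?_, ?_⟩ <;>
      simp [IsHermitian, hA, hB, hC, hN, sub_eq_add_neg]
  have hdisj : Disjoint U F := by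
    rw [Set.disjoint_left]
    rintro _ hM ⟨N, hN, rfl⟩
    exact hcon ⟨N, hN, .of_dotProduct_mulVec_pos (hGH N hN) fun w hw => hM w hw⟩
  have hUc : Convex ℝ U := by
    intro M hM M' hM' a b ha hb hab w hw
    simp only [add_mulVec, smul_mulVec, dotProduct_add, dotProduct_smul, smul_eq_mul]
    have h1 := hM w hw
    have h2 := hM' w hw
    rcases ha.eq_or_lt with rfl | ha
    · obtain rfl : b = 1 := by linarith
      linarith
    · positivity
  have hFc : Convex ℝ F := by
    rintro _ ⟨N, hN, rfl⟩ _ ⟨N', hN', rfl⟩ a b ha hb hab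
    obtain rfl : b = 1 - a := by linarith
    refine ⟨a • N + (1 - a) • N', by simp [hN, hN', add_comm], ?_⟩
    simp only [G, fromBlocks_smul, fromBlocks_add]
    congr 1
    · rw [← add_smul, hab, one_smul]
    · module
    · module
    · rw [← add_smul, hab, one_smul]
  obtain ⟨L, c, hLU, hLF⟩ :=
    geometric_hahn_banach_open hUc (isOpen_setOf_quadratic_pos _) hFc hdisj
  obtain ⟨W, hW⟩ := exists_trace_mul_eq L.toLinearMap
  replace hW : ∀ M, L M = (W * M).trace := hW
  obtain ⟨δ, hδ, hmin⟩ := exists_pos_mul_le_of_biquadratic_pos hg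
  have hIU : ∀ s : ℝ, 0 < s → ∀ v : n ⊕ n → ℝ, s • (1 : Matrix (n ⊕ n) (n ⊕ n) ℝ) +
      vecMulVec v v ∈ U := by
    intro s hs v w hw
    have h1 : 0 < w ⬝ᵥ w := by simpa using dotProduct_self_star_pos_iff.2 hw
    have h2 : w ⬝ᵥ vecMulVec v v *ᵥ w = (v ⬝ᵥ w) ^ 2 := by
      rw [vecMulVec_mulVec, dotProduct_smul, dotProduct_comm w v]
      simp [sq]
    rw [add_mulVec, dotProduct_add, h2, smul_mulVec, one_mulVec, dotProduct_smul, smul_eq_mul]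
    positivity
  have hLw : ∀ s : ℝ, 0 < s → ∀ v : n ⊕ n → ℝ, s * W.trace + v ⬝ᵥ W *ᵥ v < c := by
    intro s hs v
    have h := hLU _ (hIU s hs v)
    rwa [hW, Matrix.mul_add, trace_add, mul_vecMulVec, trace_vecMulVec, Matrix.mul_smul,
      Matrix.mul_one, trace_smul, smul_eq_mul, dotProduct_comm] at h
  have hneg : ∀ v : n ⊕ n → ℝ, v ⬝ᵥ W *ᵥ v ≤ 0 := by
    intro v
    by_contra! hq
    have h := hLw 1 one_pos (√((|c| + |W.trace|) / (v ⬝ᵥ W *ᵥ v)) • v)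
    rw [mulVec_smul, dotProduct_smul, smul_dotProduct, smul_eq_mul, smul_eq_mul, ← mul_assoc,
      Real.mul_self_sqrt (by positivity), div_mul_cancel₀ _ hq.ne'] at h
    linarith [le_abs_self c, neg_abs_le W.trace]
  let W' : Matrix (n ⊕ n) (n ⊕ n) ℝ := -(W + Wᵀ)
  have hW'M : ∀ M : Matrix (n ⊕ n) (n ⊕ n) ℝ, Mᵀ = M →
      (W' * M).trace = -2 * (W * M).trace := by
    intro M hM
    have : (Wᵀ * M).trace = (W * M).trace := by
      rw [← trace_transpose, transpose_mul, transpose_transpose, hM, trace_mul_comm]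
    simp only [W', Matrix.neg_mul, Matrix.add_mul, trace_neg, trace_add, this]
    ring
  have hW'psd : W'.PosSemidef := by
    refine .of_dotProduct_mulVec_nonneg (by simp [W', IsHermitian, add_comm]) fun v => ?_
    have h1 : v ⬝ᵥ Wᵀ *ᵥ v = v ⬝ᵥ W *ᵥ v := by
      rw [mulVec_transpose, dotProduct_comm, ← dotProduct_mulVec]
    simp only [W', star_trivial, neg_mulVec, add_mulVec, dotProduct_neg, dotProduct_add, h1]
    linarith [hneg v]
  obtain ⟨P, S, S', R, hblk⟩ : ∃ P S S' R, W' = fromBlocks P S S' R :=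
    ⟨_, _, _, _, (fromBlocks_toBlocks W').symm⟩
  have hS' : S' = Sᵀ := by
    have h := hW'psd.isHermitian
    rw [hblk, isHermitian_fromBlocks_iff] at h
    simpa using h.2.1.symm
  have hpair : ∀ N : Matrix n n ℝ, Nᵀ = -N →
      (P * A).trace + (S * B).trace + (R * C).trace - 2 * (S * N).trace ≤ -2 * c := by
    intro N hN
    have h := hLF _ ⟨N, hN, rfl⟩
    have hG := hW'M (G N) (by simpa [IsHermitian] using hGH N hN)
    rw [hW] at h
    have h1 : (Sᵀ * B).trace = (S * B).trace := by
      rw [← trace_transpose, transpose_mul, transpose_transpose, hB, trace_mul_comm]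
    have h2 : (Sᵀ * N).trace = -(S * N).trace := by
      rw [← trace_transpose, transpose_mul, transpose_transpose, hN, trace_mul_comm]
      simp
    rw [hblk, hS', fromBlocks_multiply, trace_fromBlocks_eq_add] at hG
    simp only [Matrix.mul_add, Matrix.mul_sub, Matrix.mul_smul, trace_add, trace_sub, trace_smul,
      smul_eq_mul, h1, h2] at hG
    linarith
  have hSN : ∀ N : Matrix n n ℝ, Nᵀ = -N → (S * N).trace = 0 := by
    intro N hN
    by_contra hne
    have h := hpair ((((P * A).trace + (S * B).trace + (R * C).trace + 2 * c - 1) / 2 /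
      (S * N).trace) • N) (by simp [hN])
    rw [Matrix.mul_smul, trace_smul, smul_eq_mul, div_mul_cancel₀ _ hne] at h
    linarith
  have hSt : Sᵀ = S := by
    have h := hSN (S - Sᵀ) (by simp)
    have h0 : ((S - Sᵀ)ᴴ * (S - Sᵀ)).trace = 0 := by
      have h1 : (Sᵀ * Sᵀ).trace = (S * S).trace := by
        rw [← trace_transpose, transpose_mul, transpose_transpose]
      have h2 : (Sᵀ * S).trace = (S * Sᵀ).trace := trace_mul_comm _ _
      simp only [conjTranspose_eq_transpose_of_trivial, transpose_sub, transpose_transpose,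
        Matrix.mul_sub, Matrix.sub_mul, trace_sub, h1, h2] at h ⊢
      linarith
    exact (sub_eq_zero.1 (trace_conjTranspose_mul_self_eq_zero_iff.1 h0)).symm
  have hfin := trace_pairing_nonneg (A := A - δ • 1) (B := B) (C := C - δ • 1) hSt
    (by rwa [hblk, hS', hSt] at hW'psd) fun x u v => by
      have h := hmin x u v
      simp only [sub_mulVec, dotProduct_sub, smul_mulVec, one_mulVec, dotProduct_smul, smul_eq_mul]
      linarith
  simp only [Matrix.mul_sub, Matrix.mul_smul, Matrix.mul_one, trace_sub, trace_smul,
    smul_eq_mul] at hfin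
  have htr := hW'M 1 transpose_one
  rw [Matrix.mul_one, Matrix.mul_one, hblk, trace_fromBlocks_eq_add] at htr
  have h0 := hpair 0 (by simp)
  have hδW := hLw δ hδ 0
  simp only [Matrix.mul_zero, trace_zero, mulVec_zero, dotProduct_zero] at h0 hδW
  nlinarith

open Matrix in
theorem Matrix.PosDef.exists_sum_sq {ι : Type*} [Fintype ι] [DecidableEq ι]
    {M : Matrix ι ι ℝ} (hM : M.PosDef) (e : ι) :
    ∃ (p : ι → ℝ) (K : ℕ) (v : Fin K → ι → ℝ), (∀ k, v k e = 0) ∧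
      ∀ w, w ⬝ᵥ M *ᵥ w = (p ⬝ᵥ w) ^ 2 + ∑ k, (v k ⬝ᵥ w) ^ 2 := by
  have ha : 0 < M e e := hM.diag_pos
  have hMt : Mᵀ = M := by simpa [IsHermitian] using hM.isHermitian
  let Q : Matrix ι ι ℝ := 1 - (M e e)⁻¹ • vecMulVec (Pi.single e 1) (M e)
  have hQ : ∀ w, Q *ᵥ w = w - ((M e e)⁻¹ * (M e ⬝ᵥ w)) • Pi.single e 1 := by
    intro w
    simp [Q, sub_mulVec, smul_mulVec, vecMulVec_mulVec, smul_smul]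
  have hMe : M *ᵥ Pi.single e 1 = M e := by
    ext i
    rw [mulVec_single_one, col_apply]
    exact congrFun (congrFun hMt e) i
  have heM : ∀ w, Pi.single e 1 ⬝ᵥ M *ᵥ w = M e ⬝ᵥ w := by
    intro w
    rw [single_one_dotProduct]
    rfl
  have hQM : ∀ w, w ⬝ᵥ (Qᴴ * M * Q) *ᵥ w =
      w ⬝ᵥ M *ᵥ w - (M e e)⁻¹ * (M e ⬝ᵥ w) ^ 2 := by
    intro w
    have : w ⬝ᵥ (Qᴴ * M * Q) *ᵥ w = (Q *ᵥ w) ⬝ᵥ M *ᵥ (Q *ᵥ w) := by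
      rw [← mulVec_mulVec, ← mulVec_mulVec, dotProduct_mulVec,
        conjTranspose_eq_transpose_of_trivial, vecMul_transpose]
    rw [this, hQ, mulVec_sub, mulVec_smul, hMe, sub_dotProduct, dotProduct_sub, dotProduct_sub,
      smul_dotProduct, smul_dotProduct, heM, dotProduct_smul, dotProduct_smul,
      single_one_dotProduct, dotProduct_comm w (M e)]
    simp only [smul_eq_mul]
    field_simp
    ring
  obtain ⟨K, v, hv⟩ :=
    posSemidef_iff_eq_sum_vecMulVec.1 (hM.posSemidef.conjTranspose_mul_mul_same Q)
  have hsum : ∀ w, w ⬝ᵥ (Qᴴ * M * Q) *ᵥ w = ∑ k, (v k ⬝ᵥ w) ^ 2 := by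
    intro w
    rw [hv, sum_mulVec, dotProduct_sum]
    refine Finset.sum_congr rfl fun k _ => ?_
    rw [vecMulVec_mulVec, dotProduct_smul, dotProduct_comm w, star_trivial]
    simp [sq]
  refine ⟨(√(M e e))⁻¹ • M e, K, v, fun k => ?_, fun w => ?_⟩
  · have h := (hsum (Pi.single e 1)).symm.trans (hQM _)
    rw [heM, dotProduct_single_one, sq, inv_mul_cancel_left₀ ha.ne', sub_self,
      Finset.sum_eq_zero_iff_of_nonneg fun _ _ => sq_nonneg _] at h
    simpa using h k (Finset.mem_univ k)
  · rw [← hsum, hQM, smul_dotProduct, smul_eq_mul, mul_pow, inv_pow, Real.sq_sqrt ha.le]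
    ring

theorem sum_sq_linear_expand {κ : Type*} [Fintype κ] (b c e : κ → ℝ) (y z t : ℝ) :
    ∑ k, (b k * y + c k * z + e k * t) ^ 2 =
      (∑ k, c k ^ 2) * z ^ 2 + (∑ k, 2 * b k * c k) * (y * z) + (∑ k, b k ^ 2) * y ^ 2 +
        (∑ k, 2 * c k * e k) * (z * t) + (∑ k, 2 * b k * e k) * (y * t) +
        (∑ k, e k ^ 2) * t ^ 2 := by
  simp only [Finset.sum_mul, ← Finset.sum_add_distrib]
  exact Finset.sum_congr rfl fun k _ => by ring

theorem sum_mul_mul_linear_eq {κ : Type*} [Fintype κ] {m : ℕ} (r : ℝ)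
    (β γ : κ → Fin m → ℝ) (x : Fin m → ℝ) :
    ∑ k, r * (∑ i, β k i * x i) * (∑ i, γ k i * x i) =
      ∑ i, ∑ j, (∑ k, r * β k i * γ k j) * x i * x j := by
  have h : ∀ k, r * (∑ i, β k i * x i) * (∑ i, γ k i * x i) =
      ∑ i, ∑ j, r * β k i * γ k j * x i * x j := by
    intro k
    rw [mul_assoc, Finset.sum_mul_sum, Finset.mul_sum]
    refine Finset.sum_congr rfl fun i _ => ?_
    rw [Finset.mul_sum]
    exact Finset.sum_congr rfl fun j _ => by ring
  simp only [h, Finset.sum_mul]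
  rw [Finset.sum_comm]
  exact Finset.sum_congr rfl fun i _ => Finset.sum_comm

theorem isDeg111TripartiteQuartic_sum_sq {m K : ℕ} (β γ : Fin K → Fin m → ℝ) (e : Fin K → ℝ) :
    IsDeg111TripartiteQuartic m fun x y z =>
      ∑ k, ((∑ i, β k i * x i) * y + (∑ i, γ k i * x i) * z + e k * (y * z)) ^ 2 := by
  refine ⟨fun i j => ∑ k, 1 * γ k i * γ k j, fun i j => ∑ k, 2 * β k i * γ k j,
    fun i j => ∑ k, 1 * β k i * β k j, fun i => ∑ k, 2 * γ k i * e k,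
    fun i => ∑ k, 2 * β k i * e k, ∑ k, e k ^ 2, fun x y z => ?_⟩
  have hlin : ∀ δ : Fin K → Fin m → ℝ,
      ∑ i, (∑ k, 2 * δ k i * e k) * x i = ∑ k, 2 * (∑ i, δ k i * x i) * e k := by
    intro δ
    simp only [Finset.sum_mul, Finset.mul_sum]
    rw [Finset.sum_comm]
    exact Finset.sum_congr rfl fun k _ => Finset.sum_congr rfl fun i _ => by ring
  simp only [sum_sq_linear_expand, ← sum_mul_mul_linear_eq, hlin]
  simp only [one_mul, ← sq]
  ring

theorem isSumSqQuadXYZ1_sum_sq {m K : ℕ} (β γ : Fin K → Fin m → ℝ) (e : Fin K → ℝ) :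
    IsSumSqQuadXYZ1 m K fun x y z =>
      ∑ k, ((∑ i, β k i * x i) * y + (∑ i, γ k i * x i) * z + e k * (y * z)) ^ 2 :=
  ⟨fun k x y z => (∑ i, β k i * x i) * y + (∑ i, γ k i * x i) * z + e k * (y * z),
    fun k => ⟨0, β k, γ k, 0, e k, 0, fun x y z => by simp⟩, fun _ _ _ => rfl⟩

theorem exists_of_isSumSqQuadXYZ1_sum_sq {m K K' : ℕ} {β γ : Fin K → Fin m → ℝ} {e : Fin K → ℝ}
    (h : IsSumSqQuadXYZ1 m K' fun x y z =>
      ∑ k, ((∑ i, β k i * x i) * y + (∑ i, γ k i * x i) * z + e k * (y * z)) ^ 2) :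
    ∃ (β' γ' : Fin K' → Fin m → ℝ) (e' : Fin K' → ℝ), ∀ (x : Fin m → ℝ) (y z t : ℝ),
      ∑ k, ((∑ i, β' k i * x i) * y + (∑ i, γ' k i * x i) * z + e' k * t) ^ 2 =
        ∑ k, ((∑ i, β k i * x i) * y + (∑ i, γ k i * x i) * z + e k * t) ^ 2 := by
  obtain ⟨q, hq, hsum⟩ := h
  replace hsum : ∀ x y z, ∑ k, ((∑ i, β k i * x i) * y + (∑ i, γ k i * x i) * z +
      e k * (y * z)) ^ 2 = ∑ k, q k x y z ^ 2 := hsum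
  choose A β' γ' d e' g hform using hq
  have hzero : ∀ x y z, (∑ k, ((∑ i, β k i * x i) * y + (∑ i, γ k i * x i) * z +
      e k * (y * z)) ^ 2 = 0) → ∀ k, q k x y z = 0 := by
    intro x y z h0 k
    rw [hsum, Finset.sum_eq_zero_iff_of_nonneg fun _ _ => sq_nonneg _] at h0
    exact pow_eq_zero_iff two_ne_zero |>.1 (h0 k (Finset.mem_univ k))
  have hA : ∀ k (x : Fin m → ℝ), ∑ i, ∑ j, A k i j * x i * x j = 0 := fun k x => by
    have := hzero x 0 0 (by simp) k
    rw [hform] at this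
    simpa using this
  have hd : ∀ k, d k = 0 := fun k => by
    have := hzero 0 1 0 (by simp) k
    rw [hform] at this
    simpa using this
  have hg : ∀ k, g k = 0 := fun k => by
    have := hzero 0 0 1 (by simp) k
    rw [hform] at this
    simpa using this
  refine ⟨β', γ', e', fun x y z t => ?_⟩
  have hq' : ∀ (x : Fin m → ℝ) y z,
      ∑ k, ((∑ i, β k i * x i) * y + (∑ i, γ k i * x i) * z + e k * (y * z)) ^ 2 =
        ∑ k, ((∑ i, β' k i * x i) * y + (∑ i, γ' k i * x i) * z + e' k * (y * z)) ^ 2 := by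
    intro x y z
    rw [hsum]
    refine Finset.sum_congr rfl fun k _ => ?_
    rw [hform, hA, hd, hg]
    ring
  have h1 := hq' x 0 1
  have h2 := hq' x 1 0
  have h3 := hq' x 1 1
  have h4 := hq' x 1 (-1)
  have h5 := hq' (-x) 1 1
  have h6 := hq' (-x) 1 (-1)
  simp only [sum_sq_linear_expand] at h1 h2 h3 h4 h5 h6 ⊢
  simp only [Pi.neg_apply, mul_neg, neg_mul, Finset.sum_neg_distrib, neg_sq, neg_neg] at h5 h6
  generalize (∑ k, (∑ i, γ k i * x i) ^ 2) = s1 at *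
  generalize (∑ k, (∑ i, γ' k i * x i) ^ 2) = s1' at *
  generalize (∑ k, (∑ i, β k i * x i) ^ 2) = s2 at *
  generalize (∑ k, (∑ i, β' k i * x i) ^ 2) = s2' at *
  generalize (∑ k, e k ^ 2) = s3 at *
  generalize (∑ k, e' k ^ 2) = s3' at *
  generalize (∑ k, 2 * (∑ i, β k i * x i) * (∑ i, γ k i * x i)) = s4 at *
  generalize (∑ k, 2 * (∑ i, β' k i * x i) * (∑ i, γ' k i * x i)) = s4' at *
  generalize (∑ k, 2 * (∑ i, γ k i * x i) * e k) = s5 at *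
  generalize (∑ k, 2 * (∑ i, γ' k i * x i) * e' k) = s5' at *
  generalize (∑ k, 2 * (∑ i, β k i * x i) * e k) = s6 at *
  generalize (∑ k, 2 * (∑ i, β' k i * x i) * e' k) = s6' at *
  obtain rfl : s1 = s1' := by linarith
  obtain rfl : s2 = s2' := by linarith
  obtain rfl : s4 = s4' := by linarith
  obtain rfl : s3 = s3' := by linarith
  obtain rfl : s5 = s5' := by linarith
  obtain rfl : s6 = s6' := by linarith
  rfl

open Matrix in
theorem biquadratic_eq_quadratic_in_snd {n : ℕ} (a : Fin n → Fin n → Fin 2 → Fin 2 → ℝ)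
    (x : Fin n → ℝ) (y : Fin 2 → ℝ) :
    ∑ i, ∑ j, ∑ k, ∑ l, a i j k l * x i * x j * y k * y l =
      y 0 ^ 2 * (x ⬝ᵥ (of fun i j => (a i j 0 0 + a j i 0 0) / 2) *ᵥ x) +
      y 0 * y 1 * (x ⬝ᵥ (of fun i j =>
        (a i j 0 1 + a i j 1 0 + a j i 0 1 + a j i 1 0) / 2) *ᵥ x) +
      y 1 ^ 2 * (x ⬝ᵥ (of fun i j => (a i j 1 1 + a j i 1 1) / 2) *ᵥ x) := by
  have hsymm : ∀ c : Fin n → Fin n → ℝ, x ⬝ᵥ (of fun i j => (c i j + c j i) / 2) *ᵥ x =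
      ∑ i, ∑ j, c i j * x i * x j := by
    intro c
    have h1 : ∑ i, ∑ j, c j i * x i * x j = ∑ i, ∑ j, c i j * x i * x j := by
      rw [Finset.sum_comm]
      exact Finset.sum_congr rfl fun i _ => Finset.sum_congr rfl fun j _ => by ring
    calc x ⬝ᵥ (of fun i j => (c i j + c j i) / 2) *ᵥ x
        = (∑ i, ∑ j, c i j * x i * x j + ∑ i, ∑ j, c j i * x i * x j) / 2 := by
          simp only [dotProduct, mulVec, of_apply, Finset.mul_sum, ← Finset.sum_add_distrib,
            Finset.sum_div]
          exact Finset.sum_congr rfl fun i _ => Finset.sum_congr rfl fun j _ => by ring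
      _ = _ := by rw [h1]; ring
  have hB := hsymm fun i j => a i j 0 1 + a i j 1 0
  simp only [← add_assoc] at hB
  rw [hsymm fun i j => a i j 0 0, hsymm fun i j => a i j 1 1, hB]
  simp only [Finset.mul_sum, ← Finset.sum_add_distrib, Fin.sum_univ_two]
  exact Finset.sum_congr rfl fun i _ => Finset.sum_congr rfl fun j _ => by ring

open Matrix in
theorem exists_sum_sq_of_pd_biquadratic {m : ℕ} {f : (Fin (m + 1) → ℝ) → (Fin 2 → ℝ) → ℝ}
    {a : Fin (m + 1) → Fin (m + 1) → Fin 2 → Fin 2 → ℝ}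
    (hf : ∀ x y, f x y = ∑ i, ∑ j, ∑ k, ∑ l, a i j k l * x i * x j * y k * y l)
    (hpd : ∀ (x : Fin (m + 1) → ℝ) (y : Fin 2 → ℝ), x ≠ 0 → y ≠ 0 → 0 < f x y) :
    ∃ (p : Fin (m + 1) → Fin 2 → ℝ) (K : ℕ) (β γ : Fin K → Fin m → ℝ) (e : Fin K → ℝ),
      ∀ x y, f x y = (∑ i, ∑ k, p i k * x i * y k) ^ 2 +
        ∑ k, ((∑ i, β k i * x i.succ) * y 1 + (∑ i, γ k i * x i.succ) * y 0 +
          e k * (x 0 * y 1)) ^ 2 := by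
  have hfq := fun x y => (hf x y).trans (biquadratic_eq_quadratic_in_snd a x y)
  set A : Matrix (Fin (m + 1)) (Fin (m + 1)) ℝ := of fun i j => (a i j 0 0 + a j i 0 0) / 2
  set B : Matrix (Fin (m + 1)) (Fin (m + 1)) ℝ := of fun i j =>
    (a i j 0 1 + a i j 1 0 + a j i 0 1 + a j i 1 0) / 2
  set C : Matrix (Fin (m + 1)) (Fin (m + 1)) ℝ := of fun i j => (a i j 1 1 + a j i 1 1) / 2
  obtain ⟨N, hN, hG⟩ := exists_posDef_gram_of_biquadratic_pos (A := A) (B := B) (C := C)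
    (by ext i j; simp [A, add_comm]) (by ext i j; simp [B]; ring)
    (by ext i j; simp [C, add_comm]) fun x u v hx huv => by
      have hy : (![u, v] : Fin 2 → ℝ) ≠ 0 := fun h =>
        huv (Prod.ext (by simpa using congrFun h 0) (by simpa using congrFun h 1))
      simpa [hfq] using hpd x ![u, v] hx hy
  obtain ⟨p, K, v, hv, hsum⟩ := hG.exists_sum_sq (Sum.inl 0)
  refine ⟨fun i => ![p (Sum.inl i), p (Sum.inr i)], K, fun k i => v k (Sum.inr i.succ),
    fun k i => v k (Sum.inl i.succ), fun k => v k (Sum.inr 0), fun x y => ?_⟩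
  have hw : f x y = Sum.elim (y 0 • x) (y 1 • x) ⬝ᵥ
      fromBlocks A ((1 / 2 : ℝ) • B + N) ((1 / 2 : ℝ) • B - N) C *ᵥ
        Sum.elim (y 0 • x) (y 1 • x) := by
    rw [fromBlocks_mulVec, sumElim_dotProduct_sumElim, hfq]
    simp only [Sum.elim_comp_inl, Sum.elim_comp_inr, add_mulVec, sub_mulVec, smul_mulVec,
      mulVec_smul, dotProduct_add, dotProduct_sub, dotProduct_smul, smul_dotProduct, smul_eq_mul]
    ring
  have hdot : ∀ r : Fin (m + 1) ⊕ Fin (m + 1) → ℝ, r ⬝ᵥ Sum.elim (y 0 • x) (y 1 • x) =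
      (∑ i, r (Sum.inl i) * x i) * y 0 + (∑ i, r (Sum.inr i) * x i) * y 1 := by
    intro r
    simp only [dotProduct, Fintype.sum_sum_type, Sum.elim_inl, Sum.elim_inr, Pi.smul_apply,
      smul_eq_mul, Finset.sum_mul]
    congr 1 <;> exact Finset.sum_congr rfl fun i _ => by ring
  rw [hw, hsum]
  congr 1
  · rw [hdot]
    simp [Fin.sum_univ_two, Finset.sum_add_distrib, Finset.sum_mul]
  · refine Finset.sum_congr rfl fun k _ => ?_
    rw [hdot, Fin.sum_univ_succ, Fin.sum_univ_succ (fun i => v k (Sum.inr i) * x i), hv]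
    ring

/-- For an m×2 positive definite biquadratic form `f` (m ≥ 2, here m+1
with m ≥ 1), there is an (m−1)×1×1 degenerated tripartite quartic form `h` that is a
sum of finitely many squares of quadratic forms, and whenever `h` is a sum of K
squares of quadratic forms, `f` is a sum of K+1 squares of bilinear forms; in
particular, the sos rank of `f` is at most the sos rank of `h` plus one. -/
theorem pd_biquadratic_sos_rank_via_degenerated_tripartite
    (m : ℕ) (hm : 1 ≤ m)
    (f : (Fin (m + 1) → ℝ) → (Fin 2 → ℝ) → ℝ)
    (a : Fin (m + 1) → Fin (m + 1) → Fin 2 → Fin 2 → ℝ)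
    (hf : ∀ x y, f x y = ∑ i, ∑ j, ∑ k, ∑ l, a i j k l * x i * x j * y k * y l)
    (hpd : ∀ (x : Fin (m + 1) → ℝ) (y : Fin 2 → ℝ), x ≠ 0 → y ≠ 0 → 0 < f x y) :
    ∃ h : (Fin m → ℝ) → ℝ → ℝ → ℝ,
      IsDeg111TripartiteQuartic m h ∧ (∃ K, IsSumSqQuadXYZ1 m K h) ∧
        ∀ K, IsSumSqQuadXYZ1 m K h → IsSumSqBilinear (m + 1) 2 (K + 1) f := by
  obtain ⟨p, K, β, γ, e, hsum⟩ := exists_sum_sq_of_pd_biquadratic hf hpd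
  refine ⟨_, isDeg111TripartiteQuartic_sum_sq β γ e, ⟨K, isSumSqQuadXYZ1_sum_sq β γ e⟩,
    fun K' hK' => ?_⟩
  obtain ⟨β', γ', e', hrep⟩ := exists_of_isSumSqQuadXYZ1_sum_sq hK'
  refine ⟨Fin.cons (fun x y => ∑ i, ∑ k, p i k * x i * y k) fun k x y =>
    (∑ i, β' k i * x i.succ) * y 1 + (∑ i, γ' k i * x i.succ) * y 0 + e' k * (x 0 * y 1),
    fun k => ?_, fun x y => ?_⟩
  · refine Fin.cases ⟨p, fun x y => rfl⟩ (fun k => ?_) k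
    refine ⟨Fin.cons ![0, e' k] fun i => ![γ' k i, β' k i], fun x y => ?_⟩
    simp only [Fin.cons_succ, Fin.sum_univ_succ (n := m), Fin.cons_zero, Fin.sum_univ_two,
      Matrix.cons_val_zero, Matrix.cons_val_one, Finset.sum_add_distrib, Finset.sum_mul]
    ring
  · rw [hsum, Fin.sum_univ_succ (n := K')]
    exact congrArg₂ (· + ·) rfl (hrep (fun i => x i.succ) (y 1) (y 0) (x 0 * y 1)).symm
end

section
/- Let h be a 2×1×1 degenerated tripartite quartic form, h(x₁, x₂, y, z) = h_2(x₁,x₂,y)z² + h̄_3(x₁,x₂,y)·y·z + h̄_4(x₁,x₂)·y², which is positive semidefinite. Then: (a) h_2 can be expressed as the sum of squares of 3 linear forms in (x₁,x₂,y); (b) h̄_4 can be expressed as the sum of squares of 2 linear forms in (x₁,x₂); and (c) Δ = 4·h_2·h̄_4 − h̄_3² can be expressed as the sum of squares of 3 quadratic forms in (x₁,x₂,y). -/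
open Polynomial

theorem Polynomial.nonneg_of_nonneg_on_dense {p : ℝ[X]} {s : Set ℝ} (hs : Dense s)
    (h : ∀ x ∈ s, 0 ≤ p.eval x) (x : ℝ) : 0 ≤ p.eval x := by
  have hc : IsClosed {x : ℝ | 0 ≤ p.eval x} := isClosed_le continuous_const p.continuous
  exact hc.closure_subset_iff.2 h (hs x)

theorem Polynomial.X_sub_C_sq_dvd_of_nonneg {p : ℝ[X]} (h : ∀ x, 0 ≤ p.eval x) {a : ℝ}
    (ha : p.eval a = 0) : (X - C a) ^ 2 ∣ p := by
  obtain ⟨k, rfl⟩ := dvd_iff_isRoot.2 ha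
  have hmin : IsLocalMin (fun x => ((X - C a) * k).eval x) a :=
    Filter.Eventually.of_forall fun x => by simpa only [ha] using h x
  have hd := hmin.deriv_eq_zero
  rw [Polynomial.deriv] at hd
  have hk : k.eval a = 0 := by simpa [derivative_mul] using hd
  rw [pow_two]
  exact mul_dvd_mul_left _ (dvd_iff_isRoot.2 hk)

theorem Polynomial.exists_quadratic_dvd_of_nonneg {p : ℝ[X]} (h : ∀ x, 0 ≤ p.eval x)
    (hp : 0 < p.natDegree) : ∃ a b : ℝ, (X - C a) ^ 2 + C (b ^ 2) ∣ p := by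
  obtain ⟨z, hz⟩ := Complex.exists_root (f := p.map (algebraMap ℝ ℂ)) (by
    rw [degree_map]; exact natDegree_pos_iff_degree_pos.1 hp)
  have hz' : aeval z p = 0 := by simpa [aeval_def, eval_map] using hz
  refine ⟨z.re, z.im, ?_⟩
  by_cases hi : z.im = 0
  · have hzr : z = (z.re : ℂ) := Complex.ext rfl (by simp [hi])
    rw [hi]
    simp only [ne_eq, OfNat.ofNat_ne_zero, not_false_eq_true, zero_pow, map_zero, add_zero]
    apply X_sub_C_sq_dvd_of_nonneg h
    rw [hzr] at hz'
    have := aeval_algebraMap_apply ℂ z.re p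
    simp only [Complex.coe_algebraMap] at this
    rw [this] at hz'
    simpa using hz'
  · convert quadratic_dvd_of_aeval_eq_zero_im_ne_zero p hz' hi using 1
    rw [← Complex.normSq_eq_norm_sq, Complex.normSq_apply]
    simp only [map_pow, map_mul, map_add, map_ofNat]
    ring

theorem Polynomial.nonneg_induction {P : ℕ → ℝ[X] → Prop} (hC : ∀ c, 0 ≤ c → P 0 (C c))
    (h1 : P 1 1) (hq : ∀ a b : ℝ, P 1 ((X - C a) ^ 2 + C (b ^ 2)))
    (hmul : ∀ m n p q, P m p → P n q → P (m + n) (p * q)) (n : ℕ) :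
    ∀ p : ℝ[X], p.natDegree ≤ 2 * n → (∀ x, 0 ≤ p.eval x) → P n p := by
  induction n with
  | zero =>
    intro p hp h
    rw [eq_C_of_natDegree_le_zero hp] at h ⊢
    exact hC _ (by simpa using h 0)
  | succ n ih =>
    intro p hp h
    by_cases hn : p.natDegree ≤ 2 * n
    · simpa using hmul _ _ _ _ (ih p hn h) h1
    obtain ⟨a, b, g, rfl⟩ := exists_quadratic_dvd_of_nonneg h (by omega)
    have hq2 : ((X - C a) ^ 2 + C (b ^ 2)).natDegree = 2 := by
      rw [natDegree_add_C, natDegree_pow, natDegree_X_sub_C]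
    have hg : g ≠ 0 := by rintro rfl; simp at hn
    rw [natDegree_mul (ne_zero_of_natDegree_gt (n := 1) (by omega)) hg, hq2] at hp
    rw [mul_comm]
    refine hmul _ _ _ _ (ih g (by omega) ?_) (hq a b)
    refine nonneg_of_nonneg_on_dense (dense_compl_singleton a) fun x hx => ?_
    have hpos : 0 < (x - a) ^ 2 + b ^ 2 := by
      have := sub_ne_zero.2 hx
      positivity
    have := h x
    simp only [eval_mul, eval_add, eval_pow, eval_sub, eval_X, eval_C] at this
    exact nonneg_of_mul_nonneg_right this hpos

/-- A nonnegative real polynomial is a sum of two squares. -/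
theorem Polynomial.exists_sq_add_sq_of_nonneg {n : ℕ} {p : ℝ[X]} (hp : p.natDegree ≤ 2 * n)
    (h : ∀ x, 0 ≤ p.eval x) :
    ∃ s r : ℝ[X], s.natDegree ≤ n ∧ r.natDegree ≤ n ∧ p = s ^ 2 + r ^ 2 := by
  revert p
  suffices H : ∀ p : ℝ[X], p.natDegree ≤ 2 * n → (∀ x, 0 ≤ p.eval x) →
      ∃ s r : ℝ[X], s.natDegree ≤ n ∧ r.natDegree ≤ n ∧ p = s ^ 2 + r ^ 2 from fun {p} => H p
  refine nonneg_induction (P := fun n p => ∃ s r : ℝ[X], s.natDegree ≤ n ∧ r.natDegree ≤ n ∧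
    p = s ^ 2 + r ^ 2) (fun c hc => ⟨C √c, 0, by simp, by simp, ?_⟩)
    ⟨1, 0, by simp, by simp, by ring⟩
    (fun a b => ⟨X - C a, C b, by simp, by simp, by simp⟩) ?_ n
  · rw [← C_pow, Real.sq_sqrt hc]; simp
  · rintro m n _ _ ⟨s, r, hs, hr, rfl⟩ ⟨s', r', hs', hr', rfl⟩
    refine ⟨s * s' - r * r', s * r' + r * s', ?_, ?_, by ring⟩
    · exact natDegree_sub_le_of_le (natDegree_mul_le_of_le hs hs') (natDegree_mul_le_of_le hr hr')
        |>.trans (by simp)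
    · exact natDegree_add_le_of_le (natDegree_mul_le_of_le hs hr') (natDegree_mul_le_of_le hr hs')
        |>.trans (by simp)

/-- Any monic quadratic `(X - c)² + d²` minus a suitable nonnegative multiple of
`(X - a)² + b²` is a square. -/
theorem exists_sq_add_mul (a b c d : ℝ) (hb : b ≠ 0) :
    ∃ u v m : ℝ, 0 ≤ m ∧
      ∀ x, (x - c) ^ 2 + d ^ 2 = (u * x + v) ^ 2 + m * ((x - a) ^ 2 + b ^ 2) := by
  by_cases hac : c = a
  · subst hac
    rcases le_total (b ^ 2) (d ^ 2) with h | h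
    · refine ⟨0, √(d ^ 2 - b ^ 2), 1, zero_le_one, fun x => ?_⟩
      rw [zero_mul, zero_add, Real.sq_sqrt (by linarith)]; ring
    · have hb2 : 0 < b ^ 2 := by positivity
      have hm : 0 ≤ 1 - d ^ 2 / b ^ 2 := by
        rw [sub_nonneg, div_le_one hb2]; exact h
      refine ⟨√(1 - d ^ 2 / b ^ 2), -√(1 - d ^ 2 / b ^ 2) * c, d ^ 2 / b ^ 2, by positivity,
        fun x => ?_⟩
      have : (√(1 - d ^ 2 / b ^ 2) * x + -√(1 - d ^ 2 / b ^ 2) * c) ^ 2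
          = √(1 - d ^ 2 / b ^ 2) ^ 2 * (x - c) ^ 2 := by ring
      rw [this, Real.sq_sqrt hm]
      field_simp
      ring
  · obtain ⟨m, ⟨hm0, hm1⟩, hm⟩ := intermediate_value_Icc' (zero_le_one' ℝ)
      (f := fun m => (1 - m) * (c ^ 2 + d ^ 2 - m * (a ^ 2 + b ^ 2)) - (c - m * a) ^ 2)
      (by fun_prop) (show (0 : ℝ) ∈ _ from ⟨by nlinarith [sq_nonneg (c - a)],
        by nlinarith [sq_nonneg d]⟩)
    simp only at hm
    have hlt : 0 < 1 - m := by
      rcases hm1.lt_or_eq with h | h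
      · linarith
      · subst h
        exact absurd (sub_eq_zero.1 (pow_eq_zero_iff two_ne_zero |>.1 (by linarith :
          (c - a) ^ 2 = 0))) hac
    have hs := Real.sq_sqrt hlt.le
    have hs0 := (Real.sqrt_pos.2 hlt).ne'
    refine ⟨√(1 - m), -(c - m * a) / √(1 - m), m, hm0, fun x => ?_⟩
    set e := √(1 - m)
    have hme : m = 1 - e ^ 2 := by linarith
    rw [hme] at hm ⊢
    field_simp
    linear_combination hm

/-- For a positive definite quadratic `A`, a nonnegative polynomial is of the form `s² + A r²`. -/
theorem Polynomial.exists_sq_add_mul_sq_of_nonneg {a b k : ℝ} (hb : b ≠ 0) (hk : 0 < k) {n : ℕ}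
    {p : ℝ[X]} (hp : p.natDegree ≤ 2 * n) (h : ∀ x, 0 ≤ p.eval x) :
    ∃ s r : ℝ[X], s.natDegree ≤ n ∧ (X * r).natDegree ≤ n ∧
      p = s ^ 2 + C k * ((X - C a) ^ 2 + C (b ^ 2)) * r ^ 2 := by
  revert p
  suffices H : ∀ p : ℝ[X], p.natDegree ≤ 2 * n → (∀ x, 0 ≤ p.eval x) →
      ∃ s r : ℝ[X], s.natDegree ≤ n ∧ (X * r).natDegree ≤ n ∧
        p = s ^ 2 + C k * ((X - C a) ^ 2 + C (b ^ 2)) * r ^ 2 from fun {p} => H p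
  refine nonneg_induction (P := fun n p => ∃ s r : ℝ[X], s.natDegree ≤ n ∧
    (X * r).natDegree ≤ n ∧ p = s ^ 2 + C k * ((X - C a) ^ 2 + C (b ^ 2)) * r ^ 2)
    (fun c hc => ⟨C √c, 0, by simp, by simp, ?_⟩)
    ⟨1, 0, by simp, by simp, by ring⟩ (fun c d => ?_) ?_ n
  · rw [← C_pow, Real.sq_sqrt hc]; simp
  · obtain ⟨u, v, m, hm, huv⟩ := exists_sq_add_mul a b c d hb
    refine ⟨C u * X + C v, C √(m / k), natDegree_linear_le, ?_, ?_⟩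
    · exact natDegree_mul_le_of_le natDegree_X_le (natDegree_C _).le
    · refine Polynomial.funext fun x => ?_
      simp only [eval_add, eval_pow, eval_sub, eval_X, eval_C, eval_mul]
      rw [huv, Real.sq_sqrt (by positivity)]
      field_simp
  · rintro m n _ _ ⟨s, r, hs, hr, rfl⟩ ⟨s', r', hs', hr', rfl⟩
    have hrr : (X * (X * (r * r'))).natDegree ≤ m + n := by
      rw [show X * (X * (r * r')) = X * r * (X * r') by ring]
      exact natDegree_mul_le_of_le hr hr'
    refine ⟨s * s' - C k * ((X - C a) ^ 2 + C (b ^ 2)) * (r * r'), s * r' + r * s', ?_, ?_,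
      by ring⟩
    · have hAr : (C k * ((X - C a) ^ 2 + C (b ^ 2)) * (r * r')).natDegree ≤ m + n := by
        by_cases h0 : r * r' = 0
        · simp [h0]
        · rw [natDegree_X_mul (mul_ne_zero X_ne_zero h0), natDegree_X_mul h0] at hrr
          refine (natDegree_mul_le_of_le (m := 2) (by compute_degree) le_rfl).trans ?_
          omega
      exact (natDegree_sub_le_of_le (natDegree_mul_le_of_le hs hs') hAr).trans (by simp)
    · rw [show X * (s * r' + r * s') = s * (X * r') + X * r * s' by ring]
      exact (natDegree_add_le_of_le (natDegree_mul_le_of_le hs hr')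
        (natDegree_mul_le_of_le hr hs')).trans (by simp)

/-- The polynomial `A y² + B y + C` is a sum of three squares of the form `(f y + g)²`, with
`f` of degree at most one and `g` of degree at most two. -/
def IsSumThreeSq (A B D : ℝ[X]) : Prop :=
  ∃ f g : Fin 3 → ℝ[X], (∀ i, (f i).natDegree ≤ 1) ∧ (∀ i, (g i).natDegree ≤ 2) ∧
    A = ∑ i, f i ^ 2 ∧ B = 2 * ∑ i, f i * g i ∧ D = ∑ i, g i ^ 2

theorem isSumThreeSq_of_eq_sq {l b D : ℝ[X]} (hl0 : l ≠ 0) (hl : l.natDegree ≤ 1)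
    (hb : b.natDegree ≤ 2) (hD : D.natDegree ≤ 4)
    (h : ∀ x, (l * b).eval x ^ 2 ≤ 4 * (l ^ 2).eval x * D.eval x) :
    IsSumThreeSq (l ^ 2) (l * b) D := by
  have hE : ∀ x, 0 ≤ (D - C (1 / 4) * b ^ 2).eval x := by
    refine nonneg_of_nonneg_on_dense ((l.rootSet_finite ℝ).countable.dense_compl ℝ) fun x hx => ?_
    have hx0 : l.eval x ≠ 0 := by simpa [mem_rootSet, hl0] using hx
    have hx2 : 0 < l.eval x ^ 2 := by positivity
    have := h x
    simp only [eval_mul, eval_pow, eval_sub, eval_C] at this ⊢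
    by_contra! hneg
    nlinarith [mul_neg_of_pos_of_neg hx2 hneg]
  obtain ⟨s, r, hs, hr, hsr⟩ := exists_sq_add_sq_of_nonneg (n := 2)
    (natDegree_sub_le_of_le (m := 4) (n := 4) hD
      (natDegree_mul_le_of_le (m := 0) (by simp) (natDegree_pow_le_of_le 2 hb))) hE
  have h2 : (2 : ℝ[X]) * C (1 / 2) = 1 := by
    rw [← C_ofNat, ← C_mul]; norm_num
  have h4 : C (1 / 4 : ℝ) = C (1 / 2) ^ 2 := by rw [← C_pow]; norm_num
  refine ⟨![l, 0, 0], ![C (1 / 2) * b, s, r], ?_, ?_, ?_, ?_, ?_⟩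
  · simp [Fin.forall_fin_succ, hl]
  · simp only [Fin.forall_fin_succ, Matrix.cons_val_zero, Matrix.cons_val_succ]
    exact ⟨natDegree_mul_le_of_le (m := 0) (by simp) hb |>.trans (by simp), hs, hr, by simp⟩
  · simp [Fin.sum_univ_three]
  · simp only [Fin.sum_univ_three, Matrix.cons_val]
    linear_combination -l * b * h2
  · simp only [Fin.sum_univ_three, Matrix.cons_val]
    linear_combination hsr + b ^ 2 * h4

theorem isSumThreeSq_of_posDef {a b e : ℝ} (hb : b ≠ 0) (he : e ≠ 0) {A B D : ℝ[X]}
    (hA : A = C (e ^ 2) * ((X - C a) ^ 2 + C (b ^ 2)))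
    (hB : B.natDegree ≤ 3) (hD : D.natDegree ≤ 4)
    (h : ∀ x, B.eval x ^ 2 ≤ 4 * A.eval x * D.eval x) : IsSumThreeSq A B D := by
  have he2 : 0 < e ^ 2 := by positivity
  have hA2 : A.natDegree = 2 := by
    rw [hA, natDegree_C_mul he2.ne', natDegree_add_C, natDegree_pow, natDegree_X_sub_C]
  have hA0 : A ≠ 0 := by rintro rfl; simp at hA2
  have hprime : Prime A := by
    refine (irreducible_of_degree_le_three_of_not_isRoot (by simp [hA2]) fun x hx => ?_).prime
    simp only [IsRoot, hA, eval_mul, eval_add, eval_pow, eval_sub, eval_X, eval_C] at hx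
    have : 0 < e ^ 2 * ((x - a) ^ 2 + b ^ 2) := by positivity
    exact this.ne' hx
  obtain ⟨s, r, hs, hr, hsr⟩ := exists_sq_add_mul_sq_of_nonneg (a := a) hb he2 (n := 3)
    (p := 4 * A * D - B ^ 2)
    (natDegree_sub_le_of_le (m := 6) (n := 6)
      (natDegree_mul_le_of_le (m := 2) (n := 4)
        (natDegree_mul_le_of_le (m := 0) (n := 2) (by simp) hA2.le) hD)
      (natDegree_pow_le_of_le 2 hB))
    (fun x => by simpa using h x)
  rw [← hA] at hsr
  have hr2 : r.natDegree ≤ 2 := by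
    by_cases h0 : r = 0
    · simp [h0]
    · rw [natDegree_X_mul h0] at hr; omega
  set f : ℝ[X] := C e * (X - C a) with hf
  set g : ℝ[X] := C (e * b) with hg
  have hfg : A = f ^ 2 + g ^ 2 := by
    rw [hA, hf, hg]; simp only [map_pow, map_mul]; ring
  have hf1 : f.natDegree ≤ 1 := by rw [hf]; compute_degree
  have hg0 : g.natDegree = 0 := natDegree_C _
  have hgu : IsUnit g := isUnit_C.2 (by simp [he, hb])
  obtain ⟨s, hs, hsr, hdvd⟩ : ∃ s : ℝ[X], s.natDegree ≤ 3 ∧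
      4 * A * D - B ^ 2 = s ^ 2 + A * r ^ 2 ∧ A ∣ f * B - g * s := by
    have : A ∣ (f * B - g * s) * (f * B - g * (-s)) :=
      ⟨B ^ 2 - g ^ 2 * (4 * D - r ^ 2), by linear_combination -B ^ 2 * hfg + g ^ 2 * hsr⟩
    rcases hprime.dvd_or_dvd this with h | h
    · exact ⟨s, hs, hsr, h⟩
    · exact ⟨-s, by simpa using hs, by simpa using hsr, h⟩
  obtain ⟨u, hu⟩ := hdvd
  obtain ⟨v, hv⟩ : A ∣ g * B + f * s := by
    refine hgu.dvd_mul_left.1 ⟨B - f * u, ?_⟩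
    linear_combination -B * hfg - f * hu
  have hdeg : ∀ w : ℝ[X], (A * w).natDegree ≤ 4 → w.natDegree ≤ 2 := by
    intro w hw
    by_cases h0 : w = 0
    · simp [h0]
    · rw [natDegree_mul hA0 h0, hA2] at hw; omega
  have hu2 : u.natDegree ≤ 2 := hdeg u <| hu ▸ natDegree_sub_le_of_le (m := 4) (n := 4)
    (natDegree_mul_le_of_le hf1 hB)
    ((natDegree_mul_le_of_le hg0.le hs).trans (by simp))
  have hv2 : v.natDegree ≤ 2 := hdeg v <| hv ▸ natDegree_add_le_of_le (m := 4) (n := 4)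
    ((natDegree_mul_le_of_le hg0.le hB).trans (by simp))
    (natDegree_mul_le_of_le hf1 hs)
  have hBuv : B = f * u + g * v := mul_left_cancel₀ hA0 (by
    linear_combination B * hfg + f * hu + g * hv)
  have hDuv : 4 * D = u ^ 2 + v ^ 2 + r ^ 2 := by
    refine mul_left_cancel₀ (mul_ne_zero hA0 hA0) ?_
    linear_combination A * hsr + (B ^ 2 + s ^ 2) * hfg + (f * B - g * s + A * u) * hu +
      (g * B + f * s + A * v) * hv
  have h2 : (2 : ℝ[X]) * C (1 / 2) = 1 := by
    rw [← C_ofNat, ← C_mul]; norm_num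
  have hhalf : ∀ w : ℝ[X], w.natDegree ≤ 2 → (C (1 / 2) * w).natDegree ≤ 2 := fun w hw =>
    (natDegree_C_mul_le _ _).trans hw
  refine ⟨![f, g, 0], ![C (1 / 2) * u, C (1 / 2) * v, C (1 / 2) * r], ?_, ?_, ?_, ?_, ?_⟩
  · simp [Fin.forall_fin_succ, hf1, hg0]
  · simp only [Fin.forall_fin_succ, Matrix.cons_val_zero, Matrix.cons_val_succ]
    exact ⟨hhalf u hu2, hhalf v hv2, hhalf r hr2, by simp⟩
  · simp [Fin.sum_univ_three, hfg]
  · simp only [Fin.sum_univ_three, Matrix.cons_val]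
    linear_combination hBuv - (f * u + g * v) * h2
  · simp only [Fin.sum_univ_three, Matrix.cons_val]
    linear_combination C (1 / 2) ^ 2 * hDuv - D * (2 * C (1 / 2) + 1) * h2

theorem coeff_of_quadratic_nonneg (a b c : ℝ) (h : ∀ x, 0 ≤ a * x ^ 2 + b * x + c) :
    0 ≤ a ∧ b ^ 2 ≤ 4 * a * c := by
  have hd := discrim_le_zero (a := a) (b := b) (c := c)
    fun x => by simpa only [← pow_two] using h x
  rw [discrim] at hd
  have hc : 0 ≤ c := by simpa using h 0
  refine ⟨?_, by linarith⟩
  by_contra! ha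
  nlinarith [h 1, h (-1), h ((1 + c) / -a), mul_nonneg hc hc, sq_nonneg b]

theorem isSumThreeSq_of_discrim_nonpos {p q r : ℝ} {B D : ℝ[X]} (hB : B.natDegree ≤ 3)
    (hB2 : p = 0 → B.natDegree ≤ 2) (hD : D.natDegree ≤ 4)
    (hA : ∀ x, 0 ≤ p * x ^ 2 + q * x + r) (hD0 : ∀ x, 0 ≤ D.eval x)
    (h : ∀ x, B.eval x ^ 2 ≤ 4 * (p * x ^ 2 + q * x + r) * D.eval x) :
    IsSumThreeSq (C p * X ^ 2 + C q * X + C r) B D := by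
  obtain ⟨hp0, hdisc⟩ := coeff_of_quadratic_nonneg p q r hA
  have hr0 : 0 ≤ r := by simpa using hA 0
  rcases hp0.eq_or_lt with rfl | hp
  · have hq : q = 0 := by
      have : q ^ 2 ≤ 0 := by simpa using hdisc
      exact pow_eq_zero_iff two_ne_zero |>.1 (le_antisymm this (sq_nonneg q))
    subst hq
    rcases hr0.eq_or_lt with rfl | hr
    · obtain ⟨s, t, hs, ht, hst⟩ := exists_sq_add_sq_of_nonneg (n := 2) hD hD0
      have hB0 : B = 0 := Polynomial.funext fun x => by
        have := h x
        simp only [zero_mul, mul_zero, add_zero] at this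
        simpa using pow_eq_zero_iff two_ne_zero |>.1 (le_antisymm this (sq_nonneg _))
      refine ⟨0, ![s, t, 0], by simp, ?_, by simp, by simp [hB0], by
        simp [Fin.sum_univ_three, hst]⟩
      simp [Fin.forall_fin_succ, hs, ht]
    · have hs0 := (Real.sqrt_pos.2 hr).ne'
      have hB' : B = C √r * (C (√r)⁻¹ * B) := by
        rw [← mul_assoc, ← C_mul, mul_inv_cancel₀ hs0]; simp
      have hA' : C (0 : ℝ) * X ^ 2 + C 0 * X + C r = C √r ^ 2 := by
        rw [← C_pow, Real.sq_sqrt hr.le]; simp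
      rw [hA', hB']
      refine isSumThreeSq_of_eq_sq (by simpa using hs0) (by simp)
        ((natDegree_C_mul_le _ _).trans (hB2 rfl)) hD fun x => ?_
      rw [← hB', ← hA']
      simpa using h x
  · have hs := Real.sq_sqrt hp.le
    have hs0 := (Real.sqrt_pos.2 hp).ne'
    set e := √p
    set a := -q / (2 * p) with ha
    have hn : 0 ≤ (4 * p * r - q ^ 2) / (4 * p ^ 2) := by
      apply div_nonneg <;> nlinarith
    have hb2 := Real.sq_sqrt hn
    set b := √((4 * p * r - q ^ 2) / (4 * p ^ 2))
    have hA' : ∀ x, p * x ^ 2 + q * x + r = e ^ 2 * ((x - a) ^ 2 + b ^ 2) := fun x => by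
      rw [hs, hb2, ha]; field_simp; ring
    have hAp : C p * X ^ 2 + C q * X + C r = C (e ^ 2) * ((X - C a) ^ 2 + C (b ^ 2)) :=
      Polynomial.funext fun x => by simpa using hA' x
    rw [hAp]
    by_cases hb : b = 0
    · have hBa : B.eval a = 0 := by
        have := h a
        rw [hA', hb] at this
        simp only [sub_self, ne_eq, OfNat.ofNat_ne_zero, not_false_eq_true, zero_pow, add_zero,
          mul_zero, zero_mul] at this
        exact pow_eq_zero_iff two_ne_zero |>.1 (le_antisymm this (sq_nonneg _))
      obtain ⟨k, hk⟩ := dvd_iff_isRoot.2 hBa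
      have hk2 : k.natDegree ≤ 2 := by
        by_cases h0 : k = 0
        · simp [h0]
        · rw [hk, natDegree_mul (X_sub_C_ne_zero a) h0, natDegree_X_sub_C] at hB; omega
      have hB' : B = C e * (X - C a) * (C e⁻¹ * k) := by
        have : C e * C e⁻¹ = 1 := by rw [← C_mul, mul_inv_cancel₀ hs0, C_1]
        linear_combination hk - (X - C a) * k * this
      have hA2 : C (e ^ 2) * ((X - C a) ^ 2 + C (b ^ 2)) = (C e * (X - C a)) ^ 2 := by
        simp [hb, mul_pow]
      rw [hA2, hB']
      refine isSumThreeSq_of_eq_sq (mul_ne_zero (by simpa using hs0) (X_sub_C_ne_zero a))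
        (by compute_degree) ((natDegree_C_mul_le _ _).trans hk2) hD fun x => ?_
      rw [← hB', ← hA2, ← hAp]
      simpa using h x
    · refine isSumThreeSq_of_posDef hb hs0 rfl hB hD fun x => ?_
      rw [← hAp]
      simpa using h x

/-- A nonnegative binary quadratic form is a sum of two squares of linear forms. -/
theorem exists_sq_add_sq_of_binary_nonneg {a b c : ℝ}
    (h : ∀ x y : ℝ, 0 ≤ a * x ^ 2 + b * (x * y) + c * y ^ 2) :
    ∃ u v w : ℝ, ∀ x y : ℝ,
      a * x ^ 2 + b * (x * y) + c * y ^ 2 = (u * x + v * y) ^ 2 + (w * y) ^ 2 := by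
  have ha : 0 ≤ a := by simpa using h 1 0
  have hc : 0 ≤ c := by simpa using h 0 1
  have hdisc : b ^ 2 - 4 * a * c ≤ 0 :=
    discrim_le_zero (a := a) (b := b) (c := c) fun x => by
      simpa only [← pow_two, mul_one, one_pow] using h x 1
  rcases ha.eq_or_lt with rfl | ha
  · have hb : b = 0 := pow_eq_zero_iff two_ne_zero |>.1
      (le_antisymm (by simpa using hdisc) (sq_nonneg b))
    refine ⟨0, 0, √c, fun x y => ?_⟩
    rw [mul_pow, Real.sq_sqrt hc, hb]; ring
  · have hs := Real.sq_sqrt ha.le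
    have hs0 := (Real.sqrt_pos.2 ha).ne'
    have hn : 0 ≤ c - b ^ 2 / (4 * a) := by
      rw [sub_nonneg, div_le_iff₀ (by positivity)]; linarith
    refine ⟨√a, b / (2 * √a), √(c - b ^ 2 / (4 * a)), fun x y => ?_⟩
    rw [mul_pow √(c - b ^ 2 / (4 * a)), Real.sq_sqrt hn]
    set e := √a
    rw [← hs]
    field_simp
    ring

/-- A nonnegative ternary quadratic form is a sum of three squares of linear forms. -/
theorem exists_sum_three_sq_of_ternary_nonneg {a b c d e f : ℝ}
    (h : ∀ x y z : ℝ,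
      0 ≤ a * x ^ 2 + b * (x * y) + c * y ^ 2 + d * (x * z) + e * (y * z) + f * z ^ 2) :
    ∃ l : Fin 3 → Fin 3 → ℝ, ∀ x y z : ℝ,
      a * x ^ 2 + b * (x * y) + c * y ^ 2 + d * (x * z) + e * (y * z) + f * z ^ 2 =
        ∑ t, (l t 0 * x + l t 1 * y + l t 2 * z) ^ 2 := by
  have ha : 0 ≤ a := by simpa using h 1 0 0
  rcases ha.eq_or_lt with rfl | ha
  · have hlin : ∀ k m : ℝ, (∀ x, 0 ≤ k * x + m) → k = 0 := fun k m hk => by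
      have := discrim_le_zero (a := 0) (b := k) (c := m) fun x => by simpa using hk x
      exact pow_eq_zero_iff two_ne_zero |>.1 (le_antisymm (by simpa [discrim] using this)
        (sq_nonneg k))
    have hb : b = 0 := hlin b c fun x => by simpa using h x 1 0
    have hd : d = 0 := hlin d f fun x => by simpa using h x 0 1
    subst hb hd
    obtain ⟨u, v, w, huvw⟩ := exists_sq_add_sq_of_binary_nonneg (a := c) (b := e) (c := f)
      fun y z => by simpa using h 0 y z
    refine ⟨![![0, u, v], ![0, 0, w], 0], fun x y z => ?_⟩
    simp only [Fin.sum_univ_three, Matrix.cons_val, Pi.zero_apply]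
    linear_combination huvw y z
  · obtain ⟨u, v, w, huvw⟩ := exists_sq_add_sq_of_binary_nonneg
      (a := c - b ^ 2 / (4 * a)) (b := e - b * d / (2 * a)) (c := f - d ^ 2 / (4 * a))
      fun y z => by
        convert h (-(b * y + d * z) / (2 * a)) y z using 1
        field_simp
        ring
    have hs := Real.sq_sqrt ha.le
    have hs0 := (Real.sqrt_pos.2 ha).ne'
    refine ⟨![![√a, b / (2 * √a), d / (2 * √a)], ![0, u, v], ![0, 0, w]], fun x y z => ?_⟩
    simp only [Fin.sum_univ_three, Matrix.cons_val]
    have := huvw y z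
    set r := √a
    rw [← hs] at this ⊢
    have hsq : (r * x + b / (2 * r) * y + d / (2 * r) * z) ^ 2 = r ^ 2 * x ^ 2 +
        b ^ 2 / (4 * r ^ 2) * y ^ 2 + d ^ 2 / (4 * r ^ 2) * z ^ 2 + b * (x * y) + d * (x * z) +
        b * d / (2 * r ^ 2) * (y * z) := by
      field_simp
      ring
    linear_combination this - hsq

/-- For a psd 2×1×1 degenerated tripartite quartic form
`h(x₁,x₂,y,z) = h₂(x₁,x₂,y)z² + h̄₃(x₁,x₂,y)·y·z + h̄₄(x₁,x₂)·y²`: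
(a) `h₂` is a sum of squares of 3 linear forms in (x₁,x₂,y);
(b) `h̄₄` is a sum of squares of 2 linear forms in (x₁,x₂);
(c) `Δ = 4·h₂·h̄₄ − h̄₃²` is a sum of squares of 3 quadratic forms in (x₁,x₂,y). -/
theorem deg211_h2_h4bar_Delta_sos
    (a11 a12 a22 a1y a2y ayy : ℝ)
    (c11 c12 c22 c1y c2y : ℝ)
    (d11 d12 d22 : ℝ)
    (h2 : ℝ → ℝ → ℝ → ℝ)
    (hh2 : ∀ x1 x2 y, h2 x1 x2 y =
      a11 * x1 ^ 2 + a12 * (x1 * x2) + a22 * x2 ^ 2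
        + a1y * (x1 * y) + a2y * (x2 * y) + ayy * y ^ 2)
    (h3bar : ℝ → ℝ → ℝ → ℝ)
    (hh3 : ∀ x1 x2 y, h3bar x1 x2 y =
      c11 * x1 ^ 2 + c12 * (x1 * x2) + c22 * x2 ^ 2 + c1y * (x1 * y) + c2y * (x2 * y))
    (h4bar : ℝ → ℝ → ℝ)
    (hh4 : ∀ x1 x2, h4bar x1 x2 = d11 * x1 ^ 2 + d12 * (x1 * x2) + d22 * x2 ^ 2)
    (h : ℝ → ℝ → ℝ → ℝ → ℝ)
    (hh : ∀ x1 x2 y z, h x1 x2 y z =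
      h2 x1 x2 y * z ^ 2 + h3bar x1 x2 y * (y * z) + h4bar x1 x2 * y ^ 2)
    (hpsd : ∀ x1 x2 y z, 0 ≤ h x1 x2 y z) :
    (∃ l : Fin 3 → Fin 3 → ℝ, ∀ x1 x2 y,
      h2 x1 x2 y = ∑ t, (l t 0 * x1 + l t 1 * x2 + l t 2 * y) ^ 2) ∧
    (∃ l : Fin 2 → Fin 2 → ℝ, ∀ x1 x2,
      h4bar x1 x2 = ∑ t, (l t 0 * x1 + l t 1 * x2) ^ 2) ∧
    (∃ Q : Fin 3 → Fin 6 → ℝ, ∀ x1 x2 y,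
      4 * h2 x1 x2 y * h4bar x1 x2 - (h3bar x1 x2 y) ^ 2
        = ∑ t, (Q t 0 * x1 ^ 2 + Q t 1 * (x1 * x2) + Q t 2 * x2 ^ 2
            + Q t 3 * (x1 * y) + Q t 4 * (x2 * y) + Q t 5 * y ^ 2) ^ 2) := by
  have h2nn : ∀ x1 x2 y, 0 ≤ h2 x1 x2 y := fun x1 x2 y =>
    (coeff_of_quadratic_nonneg (h2 x1 x2 y) (h3bar x1 x2 y * y) (h4bar x1 x2 * y ^ 2) fun z => by
      convert hpsd x1 x2 y z using 1; rw [hh]; ring).1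
  have h4nn : ∀ x1 x2, 0 ≤ h4bar x1 x2 := fun x1 x2 => by
    simpa [hh] using hpsd x1 x2 1 0
  have hΔ : ∀ x1 x2 y, 0 ≤ 4 * h2 x1 x2 y * h4bar x1 x2 - h3bar x1 x2 y ^ 2 := by
    intro x1 x2
    have hcl : IsClosed {y | 0 ≤ 4 * h2 x1 x2 y * h4bar x1 x2 - h3bar x1 x2 y ^ 2} := by
      simp only [hh2, hh3]
      exact isClosed_le continuous_const (by fun_prop)
    intro y
    refine hcl.closure_subset_iff.2 (fun y hy => ?_) (dense_compl_singleton (0 : ℝ) y)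
    have hy2 : 0 < y ^ 2 := by have : y ≠ 0 := hy; positivity
    have := (coeff_of_quadratic_nonneg (h2 x1 x2 y) (h3bar x1 x2 y * y) (h4bar x1 x2 * y ^ 2) fun z => by
      convert hpsd x1 x2 y z using 1; rw [hh]; ring).2
    refine nonneg_of_mul_nonneg_right (?_ : 0 ≤ y ^ 2 * _) hy2
    linarith
  refine ⟨?_, ?_, ?_⟩
  · simp only [hh2] at h2nn ⊢
    exact exists_sum_three_sq_of_ternary_nonneg h2nn
  · simp only [hh4] at h4nn ⊢
    obtain ⟨u, v, w, huvw⟩ := exists_sq_add_sq_of_binary_nonneg h4nn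
    exact ⟨![![u, v], ![0, w]], fun x y => by simpa [Fin.sum_univ_two] using huvw x y⟩
  simp only [hh2, hh3, hh4] at hΔ ⊢
  set H : ℝ[X] := C a11 * X ^ 2 + C a12 * X + C a22 with hH
  set K : ℝ[X] := C c11 * X ^ 2 + C c12 * X + C c22 with hK
  set L : ℝ[X] := C d11 * X ^ 2 + C d12 * X + C d22 with hL
  set M : ℝ[X] := C a1y * X + C a2y with hM
  set N : ℝ[X] := C c1y * X + C c2y with hN
  have hdisc (x : ℝ) := coeff_of_quadratic_nonneg _ _ _ fun y => (hΔ x 1 y).trans_eq (show _ =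
    ((4 * ayy * d11 - c1y ^ 2) * x ^ 2 + (4 * ayy * d12 - 2 * c1y * c2y) * x +
      (4 * ayy * d22 - c2y ^ 2)) * y ^ 2 + (4 * M * L - 2 * K * N).eval x * y +
      (4 * H * L - K ^ 2).eval x by
    simp only [hH, hK, hL, hM, hN, eval_sub, eval_mul, eval_add, eval_pow, eval_X, eval_C,
      eval_ofNat]
    ring)
  have hB : 4 * M * L - 2 * K * N = C (4 * a1y * d11 - 2 * c11 * c1y) * X ^ 3 +
      C (4 * (a1y * d12 + a2y * d11) - 2 * (c11 * c2y + c12 * c1y)) * X ^ 2 +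
      C (4 * (a1y * d22 + a2y * d12) - 2 * (c12 * c2y + c22 * c1y)) * X +
      C (4 * a2y * d22 - 2 * c22 * c2y) := by
    simp only [hK, hL, hM, hN, map_sub, map_mul, map_add, map_ofNat]
    ring
  obtain ⟨f, g, hf, hg, hfA, hfB, hfC⟩ := isSumThreeSq_of_discrim_nonpos
    (p := 4 * ayy * d11 - c1y ^ 2) (q := 4 * ayy * d12 - 2 * c1y * c2y)
    (r := 4 * ayy * d22 - c2y ^ 2) (B := 4 * M * L - 2 * K * N) (D := 4 * H * L - K ^ 2)
    (by rw [hB]; exact natDegree_cubic_le)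
    (fun hp => by
      have h3 : 4 * a1y * d11 - 2 * c11 * c1y = 0 := by
        have := (coeff_of_quadratic_nonneg (4 * ayy * d11 - c1y ^ 2) (4 * a1y * d11 - 2 * c11 * c1y)
          (4 * a11 * d11 - c11 ^ 2) fun y => by convert hΔ 1 0 y using 1; ring).2
        rw [hp] at this
        exact pow_eq_zero_iff two_ne_zero |>.1
          (le_antisymm (by simpa using this) (sq_nonneg _))
      rw [hB, h3, C_0, zero_mul, zero_add]
      exact natDegree_quadratic_le)
    (by rw [hH, hK, hL]; compute_degree)
    (fun x => (hdisc x).1)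
    (fun x => by
      convert hΔ x 1 0 using 1
      simp only [hH, hK, hL, eval_sub, eval_mul, eval_add, eval_pow, eval_X, eval_C, eval_ofNat]
      ring)
    (fun x => (hdisc x).2)
  refine ⟨fun t => ![(g t).coeff 2, (g t).coeff 1, (g t).coeff 0, (f t).coeff 1, (f t).coeff 0, 0],
    fun x1 x2 y => ?_⟩
  have hfe : ∀ i x, (f i).eval x = (f i).coeff 1 * x + (f i).coeff 0 := fun i x => by
    rw [eval_eq_sum_range' (Nat.lt_succ_of_le (hf i))]
    simp [Finset.sum_range_succ]; ring
  have hge : ∀ i x, (g i).eval x = (g i).coeff 2 * x ^ 2 + (g i).coeff 1 * x + (g i).coeff 0 :=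
    fun i x => by
      rw [eval_eq_sum_range' (Nat.lt_succ_of_le (hg i))]
      simp [Finset.sum_range_succ]; ring
  simp only [Fin.sum_univ_three, Matrix.cons_val] at hfA hfB hfC ⊢
  revert x2
  rw [← funext_iff]
  refine Continuous.ext_on (dense_compl_singleton (0 : ℝ)) (by fun_prop) (by fun_prop)
    fun x2 hx2 => ?_
  have hx2' : x2 ≠ 0 := hx2
  obtain ⟨t, rfl⟩ : ∃ t, x1 = t * x2 := ⟨x1 / x2, by field_simp⟩
  have eA := congrArg (eval t) hfA
  have eB := congrArg (eval t) hfB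
  have eC := congrArg (eval t) hfC
  simp only [hH, hK, hL, hM, hN, eval_sub, eval_mul, eval_add, eval_pow, eval_X, eval_C,
    eval_ofNat, hfe, hge] at eA eB eC
  linear_combination x2 ^ 2 * y ^ 2 * eA + x2 ^ 3 * y * eB + x2 ^ 4 * eC
end

section
/- Let Δ : ℝ³ → ℝ be a positive semidefinite quartic form of the shape Δ(x₁, x₂, y) = Δ_0(x₁,x₂)y² + Δ_1(x₁,x₂)y + Δ_2(x₁,x₂), where Δ_0 is a binary quadratic form, Δ_1 is a binary cubic form, and Δ_2 is a binary quartic form. Then there exist binary quadratic forms ξ(x₁,x₂), s_1(x₁,x₂), s_2(x₁,x₂) and binary linear forms l_1(x₁,x₂), l_2(x₁,x₂) such that identically Δ(x₁,x₂,y) = ξ(x₁,x₂)² + (s_1(x₁,x₂) + l_1(x₁,x₂)y)² + (s_2(x₁,x₂) + l_2(x₁,x₂)y)². -/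
open Polynomial

/-- A continuous function which is nonnegative away from a point is nonnegative. -/
theorem Continuous.nonneg_of_forall_ne {f : ℝ → ℝ} (hf : Continuous f) (a : ℝ)
    (h : ∀ t, t ≠ a → 0 ≤ f t) (t : ℝ) : 0 ≤ f t := by
  have hsub : ({a}ᶜ : Set ℝ) ⊆ {t | 0 ≤ f t} := fun t ht => h t ht
  have hcl := (isClosed_le continuous_const hf).closure_subset_iff.2 hsub
  rw [(dense_compl_singleton a).closure_eq] at hcl
  exact hcl (Set.mem_univ t)

/-- A nonnegative nonconstant real polynomial is divisible by some `(X - a)² + b²`. -/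
theorem Polynomial.exists_sq_add_sq_dvd_of_nonneg {p : ℝ[X]} (hp : ∀ t, 0 ≤ p.eval t)
    (hdeg : 0 < p.natDegree) :
    ∃ a b : ℝ, (X - C a) ^ 2 + C (b ^ 2) ∣ p := by
  obtain ⟨z, hz⟩ := IsAlgClosed.exists_aeval_eq_zero ℂ p
    (natDegree_pos_iff_degree_pos.1 hdeg).ne'
  by_cases him : z.im = 0
  · refine ⟨z.re, 0, ?_⟩
    have hzr : (algebraMap ℝ ℂ) z.re = z := by
      apply Complex.ext <;> simp [him]
    have hroot : p.eval z.re = 0 := by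
      rw [← hzr, aeval_algebraMap_apply] at hz
      simpa using hz
    obtain ⟨q, rfl⟩ := dvd_iff_isRoot.2 hroot
    have hmin : IsLocalMin (fun t => ((X - C z.re) * q).eval t) z.re :=
      Filter.Eventually.of_forall fun t => by
        simpa only [hroot] using hp t
    have hder := hmin.deriv_eq_zero
    rw [Polynomial.deriv] at hder
    have hq : q.eval z.re = 0 := by simpa using hder
    obtain ⟨r, rfl⟩ := dvd_iff_isRoot.2 hq
    exact ⟨r, by simp; ring⟩
  · refine ⟨z.re, z.im, ?_⟩
    have h := p.quadratic_dvd_of_aeval_eq_zero_im_ne_zero hz him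
    convert h using 1
    rw [Complex.sq_norm, Complex.normSq_apply]
    simp only [map_add, map_mul, map_pow, map_ofNat]
    ring

/-- If every `(X - a)² + b²` is represented by the form `η² + Q ξ²` with `η` of degree at most one
and `ξ` constant, then every nonnegative real polynomial is represented by that form. -/
theorem Polynomial.exists_eq_sq_add_mul_sq_of_nonneg {Q : ℝ[X]} (hQdeg : Q.natDegree ≤ 2)
    (hQ : ∀ a b : ℝ, ∃ (η : ℝ[X]) (r : ℝ), η.natDegree ≤ 1 ∧
      (X - C a) ^ 2 + C (b ^ 2) = η ^ 2 + Q * C r ^ 2) (n : ℕ) :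
    ∀ p : ℝ[X], (∀ t, 0 ≤ p.eval t) → p.natDegree ≤ 2 * n →
      ∃ η ξ : ℝ[X], η.natDegree ≤ n ∧ ξ.degree < n ∧ p = η ^ 2 + Q * ξ ^ 2 := by
  induction n with
  | zero =>
    intro p hp hdeg
    rw [eq_C_of_natDegree_le_zero (by simpa using hdeg : p.natDegree ≤ 0)] at hp ⊢
    have h0 := hp 0
    rw [eval_C] at h0
    refine ⟨C √(p.coeff 0), 0, by simp, by simp, ?_⟩
    rw [← C_pow, Real.sq_sqrt h0]
    ring
  | succ n ih =>
    intro p hp hdeg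
    by_cases hsmall : p.natDegree ≤ 2 * n
    · obtain ⟨η, ξ, h1, h2, h3⟩ := ih p hp hsmall
      exact ⟨η, ξ, by omega, h2.trans (by exact_mod_cast n.lt_succ_self), h3⟩
    obtain ⟨a, b, q, rfl⟩ := exists_sq_add_sq_dvd_of_nonneg hp (by omega)
    have hmon : ((X - C a) ^ 2 + C (b ^ 2) : ℝ[X]).Monic := by monicity!
    have hnd : ((X - C a) ^ 2 + C (b ^ 2) : ℝ[X]).natDegree = 2 := by compute_degree!
    have hq0 : q ≠ 0 := by
      rintro rfl
      simp at hsmall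
    have hqdeg : q.natDegree ≤ 2 * n := by
      rw [hmon.natDegree_mul' hq0, hnd] at hdeg
      omega
    have hq : ∀ t, 0 ≤ q.eval t := by
      refine q.continuous.nonneg_of_forall_ne a fun t ht => ?_
      have h := hp t
      have hpos : 0 < (t - a) ^ 2 + b ^ 2 := by
        have := sub_ne_zero.2 ht
        positivity
      simp only [eval_mul, eval_add, eval_pow, eval_sub, eval_X, eval_C] at h
      exact (mul_nonneg_iff_of_pos_left hpos).1 h
    obtain ⟨η, ξ, hη, hξ, rfl⟩ := ih q hq hqdeg
    obtain ⟨μ, r, hμ, hr⟩ := hQ a b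
    have hξle : (C r * ξ).degree < n := by
      refine lt_of_le_of_lt ?_ hξ
      rw [← smul_eq_C_mul]
      exact degree_smul_le r ξ
    refine ⟨μ * η - Q * (C r * ξ), μ * ξ + C r * η, ?_, ?_, by rw [hr]; ring⟩
    · refine (natDegree_sub_le _ _).trans (max_le ?_ ?_)
      · exact natDegree_mul_le.trans (by omega)
      · by_cases h0 : C r * ξ = 0
        · simp [h0]
        · have := (natDegree_lt_iff_degree_lt h0).2 hξle
          exact natDegree_mul_le.trans (by omega)
    · refine (degree_add_le _ _).trans_lt (max_lt ?_ ?_)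
      · by_cases h0 : ξ = 0
        · simp [h0]
        · have := (natDegree_lt_iff_degree_lt h0).2 hξ
          refine degree_le_natDegree.trans_lt ?_
          exact_mod_cast natDegree_mul_le.trans_lt (by omega)
      · refine degree_le_natDegree.trans_lt ?_
        exact_mod_cast natDegree_mul_le.trans_lt (by rw [natDegree_C]; omega)

/-- Simultaneous diagonalization of `(X - a)² + b²` with a positive definite quadratic. -/
theorem Polynomial.exists_sq_add_sq_eq_sq_add_quadratic {e0 e1 e2 : ℝ} (he0 : 0 < e0)
    (hdisc : e1 ^ 2 < 4 * e0 * e2) (a b : ℝ) :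
    ∃ (η : ℝ[X]) (r : ℝ), η.natDegree ≤ 1 ∧
      (X - C a) ^ 2 + C (b ^ 2) = η ^ 2 + (C e0 * X ^ 2 + C e1 * X + C e2) * C r ^ 2 := by
  suffices h : ∃ u v w : ℝ, 0 ≤ w ∧ u ^ 2 + w * e0 = 1 ∧ 2 * (u * v) + w * e1 = -2 * a ∧
      v ^ 2 + w * e2 = a ^ 2 + b ^ 2 by
    obtain ⟨u, v, w, hw, h1, h2, h3⟩ := h
    refine ⟨C u * X + C v, √w, natDegree_linear_le, funext fun t => ?_⟩
    simp only [eval_mul, eval_add, eval_pow, eval_sub, eval_X, eval_C, Real.sq_sqrt hw]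
    linear_combination -t ^ 2 * h1 - t * h2 - h3
  by_cases hcen : 2 * a * e0 + e1 = 0
  · obtain rfl : e1 = -2 * a * e0 := by linarith
    have hB : 0 < e2 - a ^ 2 * e0 := by
      by_contra hneg
      nlinarith
    by_cases hb : e2 - a ^ 2 * e0 ≤ b ^ 2 * e0
    · refine ⟨0, √(b ^ 2 - (e2 - a ^ 2 * e0) / e0), 1 / e0, by positivity, by field_simp; simp,
        by field_simp; ring, ?_⟩
      rw [Real.sq_sqrt (by rw [sub_nonneg, div_le_iff₀ he0]; exact hb)]
      field_simp
      ring
    · push Not at hb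
      have hs : 0 ≤ 1 - b ^ 2 / (e2 - a ^ 2 * e0) * e0 := by
        rw [sub_nonneg, div_mul_eq_mul_div, div_le_one hB]
        exact hb.le
      refine ⟨√(1 - b ^ 2 / (e2 - a ^ 2 * e0) * e0), -a * √(1 - b ^ 2 / (e2 - a ^ 2 * e0) * e0),
        b ^ 2 / (e2 - a ^ 2 * e0), by positivity, ?_, ?_, ?_⟩
      · rw [Real.sq_sqrt hs]; ring
      · linear_combination (-2 * a) * Real.sq_sqrt hs
      · have := div_mul_cancel₀ (b ^ 2) hB.ne'
        linear_combination a ^ 2 * Real.sq_sqrt hs + this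
  · let h : ℝ → ℝ := fun w => 4 * (1 - w * e0) * (a ^ 2 + b ^ 2 - w * e2) - (2 * a + w * e1) ^ 2
    have hcont : Continuous h := by fun_prop
    have h0 : 0 ≤ h 0 := by
      simp only [h]
      nlinarith [sq_nonneg b]
    have h1 : h (1 / e0) < 0 := by
      have hval : h (1 / e0) = -((2 * a * e0 + e1) / e0) ^ 2 := by
        simp only [h]
        field_simp
        ring
      have : (2 * a * e0 + e1) / e0 ≠ 0 := div_ne_zero hcen he0.ne'
      rw [hval]
      have := sq_pos_of_ne_zero this
      linarith
    obtain ⟨w, ⟨hw0, hw1⟩, hw⟩ := intermediate_value_Icc' (by positivity : (0 : ℝ) ≤ 1 / e0)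
      hcont.continuousOn ⟨h1.le, h0⟩
    have hlt : w < 1 / e0 := lt_of_le_of_ne hw1 fun heq => by
      rw [heq] at hw
      exact h1.ne hw
    have hs : 0 < 1 - w * e0 := by
      rw [lt_div_iff₀ he0] at hlt
      linarith
    have hsq := Real.sq_sqrt hs.le
    have hspos := Real.sqrt_pos.2 hs
    simp only [h] at hw
    refine ⟨√(1 - w * e0), -(2 * a + w * e1) / (2 * √(1 - w * e0)), w, hw0, by linarith, ?_, ?_⟩
    · field_simp
      ring
    · rw [div_pow, mul_pow, hsq]
      field_simp
      linarith

/-- The coefficients of a polynomial of degree at most two. -/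
theorem Polynomial.exists_eval_eq_of_natDegree_le_two {p : ℝ[X]} (hp : p.natDegree ≤ 2) :
    ∃ a b c : ℝ, ∀ t, p.eval t = a * t ^ 2 + b * t + c := by
  refine ⟨p.coeff 2, p.coeff 1, p.coeff 0, fun t => ?_⟩
  rw [eval_eq_sum_range' (n := 3) (by omega)]
  simp only [Finset.sum_range_succ, Finset.sum_range_zero]
  ring

/-- A nonnegative polynomial of degree at most four is a sum of two squares. -/
theorem exists_quartic_eq_sq_add_sq {g0 g1 g2 g3 g4 : ℝ}
    (h : ∀ t : ℝ, 0 ≤ g0 * t ^ 4 + g1 * t ^ 3 + g2 * t ^ 2 + g3 * t + g4) :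
    ∃ a0 a1 a2 b0 b1 b2 : ℝ, ∀ t : ℝ, g0 * t ^ 4 + g1 * t ^ 3 + g2 * t ^ 2 + g3 * t + g4 =
      (a0 * t ^ 2 + a1 * t + a2) ^ 2 + (b0 * t ^ 2 + b1 * t + b2) ^ 2 := by
  obtain ⟨η, ξ, hη, hξ, heq⟩ := exists_eq_sq_add_mul_sq_of_nonneg (Q := 1) (by simp)
    (fun a b => ⟨X - C a, b, by simp, by simp⟩) 2
    (C g0 * X ^ 4 + C g1 * X ^ 3 + C g2 * X ^ 2 + C g3 * X + C g4)
    (fun t => by simpa using h t) (by compute_degree)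
  obtain ⟨a0, a1, a2, ha⟩ := exists_eval_eq_of_natDegree_le_two hη
  obtain ⟨b0, b1, b2, hb⟩ := exists_eval_eq_of_natDegree_le_two
    (natDegree_le_of_degree_le hξ.le)
  refine ⟨a0, a1, a2, b0, b1, b2, fun t => ?_⟩
  have := congrArg (eval t) heq
  simpa [ha, hb] using this

/-- Factorization of a nonnegative `2 × 2` polynomial matrix `!![Q, c; c, D]` whose corner
`Q = l² + γ²` is a positive definite quadratic. -/
theorem Polynomial.exists_sq_add_sq_add_sq_of_nonneg_det {Q l c D : ℝ[X]} {γ : ℝ} (hγ : γ ≠ 0)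
    (hl : l.natDegree ≤ 1) (hQ : Q = l ^ 2 + C γ ^ 2) (hQdeg : Q.natDegree = 2)
    (hc : c.natDegree ≤ 3) {η ξ : ℝ[X]} (hη : η.natDegree ≤ 3)
    (hdet : Q * D - c ^ 2 = η ^ 2 + Q * ξ ^ 2) :
    ∃ s₁ s₂ : ℝ[X], s₁.natDegree ≤ 2 ∧ s₂.natDegree ≤ 2 ∧ c = l * s₁ + C γ * s₂ ∧
      D = ξ ^ 2 + s₁ ^ 2 + s₂ ^ 2 := by
  have hQ0 : Q ≠ 0 := by
    rintro rfl
    simp at hQdeg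
  have hprime : Prime Q := by
    refine (Irreducible.prime ?_)
    rw [irreducible_iff_roots_eq_zero_of_degree_le_three (by omega) (by omega)]
    refine Multiset.eq_zero_of_forall_notMem fun t ht => ?_
    have h := (mem_roots hQ0).1 ht
    simp only [hQ, IsRoot, eval_add, eval_pow, eval_C] at h
    have := sq_pos_of_ne_zero hγ
    nlinarith [sq_nonneg (l.eval t)]
  wlog hdvd : Q ∣ l * c - C γ * η generalizing η
  · refine this (η := -η) (by simpa using hη) (by simpa using hdet) ?_
    have hprod : Q ∣ (l * c - C γ * η) * (l * c + C γ * η) :=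
      ⟨l ^ 2 * (D - ξ ^ 2) - η ^ 2, by linear_combination (-l ^ 2) * hdet + η ^ 2 * hQ⟩
    have := (hprime.dvd_or_dvd hprod).resolve_left hdvd
    simpa using this
  have hunit : IsUnit (C γ : ℝ[X]) := isUnit_C.2 (isUnit_iff_ne_zero.2 hγ)
  have hdvd' : Q ∣ C γ * c + l * η := by
    refine (hunit.dvd_mul_left).1 ?_
    have h : C γ * (C γ * c + l * η) = Q * c - l * (l * c - C γ * η) := by
      linear_combination (-c) * hQ
    rw [h]
    exact dvd_sub (dvd_mul_right _ _) (hdvd.mul_left _)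
  obtain ⟨s₁, h₁⟩ := hdvd
  obtain ⟨s₂, h₂⟩ := hdvd'
  have hdeg : ∀ s : ℝ[X], (Q * s).natDegree ≤ 4 → s.natDegree ≤ 2 := by
    intro s hs
    by_cases h0 : s = 0
    · simp [h0]
    · rw [natDegree_mul hQ0 h0] at hs
      omega
  have hCγ : (C γ : ℝ[X]).natDegree = 0 := natDegree_C γ
  refine ⟨s₁, s₂, hdeg _ ?_, hdeg _ ?_, mul_left_cancel₀ hQ0 ?_,
    mul_left_cancel₀ hQ0 (mul_left_cancel₀ hQ0 ?_)⟩
  · rw [← h₁]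
    exact (natDegree_sub_le _ _).trans (max_le (natDegree_mul_le.trans (by omega))
      (natDegree_mul_le.trans (by omega)))
  · rw [← h₂]
    exact (natDegree_add_le _ _).trans (max_le (natDegree_mul_le.trans (by omega))
      (natDegree_mul_le.trans (by omega)))
  · linear_combination c * hQ + l * h₁ + C γ * h₂
  · linear_combination Q * hdet + (c ^ 2 + η ^ 2) * hQ + (l * c - C γ * η + Q * s₁) * h₁ +
      (C γ * c + l * η + Q * s₂) * h₂

/-- A quadratic polynomial is nonnegative only if its leading coefficient is nonnegative and its
discriminant is nonpositive. -/
theorem leading_nonneg_and_sq_le_of_quadratic_nonneg {a b c : ℝ}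
    (h : ∀ y : ℝ, 0 ≤ a * y ^ 2 + b * y + c) : 0 ≤ a ∧ b ^ 2 ≤ 4 * a * c := by
  have hdisc : b ^ 2 ≤ 4 * a * c := by
    have := discrim_le_zero (a := a) (b := b) (c := c) fun y => by
      linarith [h y, sq y]
    rw [discrim] at this
    linarith
  refine ⟨?_, hdisc⟩
  by_contra! ha
  have hc : 0 ≤ c := by simpa using h 0
  have hb : b = 0 := by nlinarith [mul_nonneg (neg_nonneg.2 ha.le) hc]
  have h1 := h (1 + c / -a)
  have hca : 0 ≤ c / -a := div_nonneg hc (by linarith)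
  have hne : a ≠ 0 := ha.ne
  have hmul : a * (c / -a) = -c := by field_simp
  subst hb
  nlinarith [mul_nonneg (neg_nonneg.2 ha.le) (sq_nonneg (c / -a))]

/-- The dehomogenized decomposition when the coefficient of `y²` is positive definite. -/
theorem exists_sos_of_definite {e0 e1 e2 f0 f1 f2 f3 g0 g1 g2 g3 g4 : ℝ}
    (he0 : 0 < e0) (hdisc : e1 ^ 2 < 4 * e0 * e2)
    (h : ∀ t : ℝ, (f0 * t ^ 3 + f1 * t ^ 2 + f2 * t + f3) ^ 2 ≤
      4 * (e0 * t ^ 2 + e1 * t + e2) * (g0 * t ^ 4 + g1 * t ^ 3 + g2 * t ^ 2 + g3 * t + g4)) :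
    ∃ ξ0 ξ1 ξ2 s10 s11 s12 s20 s21 s22 l10 l11 l20 l21 : ℝ, ∀ t : ℝ,
      e0 * t ^ 2 + e1 * t + e2 = (l10 * t + l11) ^ 2 + (l20 * t + l21) ^ 2 ∧
      f0 * t ^ 3 + f1 * t ^ 2 + f2 * t + f3 =
        2 * ((l10 * t + l11) * (s10 * t ^ 2 + s11 * t + s12) +
          (l20 * t + l21) * (s20 * t ^ 2 + s21 * t + s22)) ∧
      g0 * t ^ 4 + g1 * t ^ 3 + g2 * t ^ 2 + g3 * t + g4 =
        (ξ0 * t ^ 2 + ξ1 * t + ξ2) ^ 2 + (s10 * t ^ 2 + s11 * t + s12) ^ 2 +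
          (s20 * t ^ 2 + s21 * t + s22) ^ 2 := by
  obtain ⟨α, β, γ, hγ, h0, h1, h2⟩ : ∃ α β γ : ℝ, γ ≠ 0 ∧ e0 = α ^ 2 ∧ e1 = 2 * (α * β) ∧
      e2 = β ^ 2 + γ ^ 2 := by
    have hpos : 0 < e2 - e1 ^ 2 / (4 * e0) := by
      rw [sub_pos, div_lt_iff₀ (by positivity)]
      linarith
    have hα := Real.sqrt_pos.2 he0
    have hα2 := Real.sq_sqrt he0.le
    refine ⟨√e0, e1 / (2 * √e0), √(e2 - e1 ^ 2 / (4 * e0)), (Real.sqrt_pos.2 hpos).ne', hα2.symm,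
      by field_simp, ?_⟩
    rw [Real.sq_sqrt hpos.le, div_pow, mul_pow, hα2]
    ring
  set Q : ℝ[X] := C e0 * X ^ 2 + C e1 * X + C e2 with hQ
  set c : ℝ[X] := C (f0 / 2) * X ^ 3 + C (f1 / 2) * X ^ 2 + C (f2 / 2) * X + C (f3 / 2) with hc
  set D : ℝ[X] := C g0 * X ^ 4 + C g1 * X ^ 3 + C g2 * X ^ 2 + C g3 * X + C g4 with hD
  have hQe : ∀ t, Q.eval t = e0 * t ^ 2 + e1 * t + e2 := fun t => by simp [hQ]
  have hce : ∀ t, c.eval t = (f0 * t ^ 3 + f1 * t ^ 2 + f2 * t + f3) / 2 := fun t => by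
    simp [hc]
    ring
  have hDe : ∀ t, D.eval t = g0 * t ^ 4 + g1 * t ^ 3 + g2 * t ^ 2 + g3 * t + g4 := fun t => by
    simp [hD]
  have hQdeg : Q.natDegree = 2 := natDegree_quadratic he0.ne'
  have hcdeg : c.natDegree ≤ 3 := by rw [hc]; compute_degree
  have hDdeg : D.natDegree ≤ 4 := by rw [hD]; compute_degree
  obtain ⟨η, ξ, hη, hξ, hdet⟩ := exists_eq_sq_add_mul_sq_of_nonneg hQdeg.le
    (exists_sq_add_sq_eq_sq_add_quadratic he0 hdisc) 3 (Q * D - c ^ 2)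
    (fun t => by
      simp only [eval_sub, eval_mul, eval_pow, hQe, hce, hDe]
      linarith [h t])
    ((natDegree_sub_le _ _).trans (max_le (natDegree_mul_le.trans (by omega))
      (natDegree_pow_le.trans (by omega))))
  have hξ2 : ξ.natDegree ≤ 2 := by
    by_cases hξ0 : ξ = 0
    · simp [hξ0]
    · have := (natDegree_lt_iff_degree_lt hξ0).2 hξ
      omega
  have hQl : Q = (C α * X + C β) ^ 2 + C γ ^ 2 := funext fun t => by
    simp [hQe, h0, h1, h2]
    ring
  obtain ⟨s₁, s₂, hs₁, hs₂, hcs, hDs⟩ := exists_sq_add_sq_add_sq_of_nonneg_det hγ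
    natDegree_linear_le hQl hQdeg hcdeg hη hdet
  obtain ⟨a0, a1, a2, ha⟩ := exists_eval_eq_of_natDegree_le_two hξ2
  obtain ⟨b0, b1, b2, hb⟩ := exists_eval_eq_of_natDegree_le_two hs₁
  obtain ⟨d0, d1, d2, hd⟩ := exists_eval_eq_of_natDegree_le_two hs₂
  refine ⟨a0, a1, a2, b0, b1, b2, d0, d1, d2, α, β, 0, γ, fun t => ⟨?_, ?_, ?_⟩⟩
  · rw [h0, h1, h2]
    ring
  · have := congrArg (eval t) hcs
    simp only [hce, eval_add, eval_mul, eval_C, eval_X, hb, hd] at this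
    linarith
  · have := congrArg (eval t) hDs
    simpa only [hDe, eval_add, eval_pow, ha, hb, hd] using this

/-- If the coefficient of `y²` in a psd form is degenerate, then a square `(c + l y)²` can be
split off, leaving a nonnegative quartic. -/
theorem exists_split_square_of_degenerate {e0 e1 e2 f0 f1 f2 f3 g0 g1 g2 g3 g4 : ℝ}
    (hdisc : 4 * e0 * e2 ≤ e1 ^ 2) (he0 : 0 ≤ e0) (hf0 : f0 ^ 2 ≤ 4 * e0 * g0)
    (hE : ∀ t : ℝ, 0 ≤ e0 * t ^ 2 + e1 * t + e2)
    (hG : ∀ t : ℝ, 0 ≤ g0 * t ^ 4 + g1 * t ^ 3 + g2 * t ^ 2 + g3 * t + g4)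
    (h : ∀ t : ℝ, (f0 * t ^ 3 + f1 * t ^ 2 + f2 * t + f3) ^ 2 ≤
      4 * (e0 * t ^ 2 + e1 * t + e2) * (g0 * t ^ 4 + g1 * t ^ 3 + g2 * t ^ 2 + g3 * t + g4)) :
    ∃ l0 l1 c0 c1 c2 : ℝ, ∀ t : ℝ, e0 * t ^ 2 + e1 * t + e2 = (l0 * t + l1) ^ 2 ∧
      f0 * t ^ 3 + f1 * t ^ 2 + f2 * t + f3 = 2 * ((l0 * t + l1) * (c0 * t ^ 2 + c1 * t + c2)) ∧
      0 ≤ g0 * t ^ 4 + g1 * t ^ 3 + g2 * t ^ 2 + g3 * t + g4 - (c0 * t ^ 2 + c1 * t + c2) ^ 2 := by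
  rcases he0.eq_or_lt with rfl | hpos
  · have he1 : e1 = 0 := by
      by_contra hne
      have h1 := hE ((-1 - e2) / e1)
      rw [mul_div_cancel₀ _ hne] at h1
      linarith
    have hf : f0 = 0 := by nlinarith
    subst he1 hf
    have he2 : 0 ≤ e2 := by simpa using hE 0
    rcases he2.eq_or_lt with rfl | he2
    · refine ⟨0, 0, 0, 0, 0, fun t => ⟨by ring, ?_, by simpa using hG t⟩⟩
      have := h t
      nlinarith
    · have hs := Real.sqrt_pos.2 he2
      have hs2 := Real.sq_sqrt he2.le
      refine ⟨0, √e2, f1 / (2 * √e2), f2 / (2 * √e2), f3 / (2 * √e2), fun t =>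
        ⟨by linear_combination -hs2, by field_simp; ring, ?_⟩⟩
      have hsq : (f1 / (2 * √e2) * t ^ 2 + f2 / (2 * √e2) * t + f3 / (2 * √e2)) ^ 2 =
          (f1 * t ^ 2 + f2 * t + f3) ^ 2 / (4 * e2) := by
        rw [← hs2]
        simp only [Real.sqrt_sq hs.le]
        field_simp
        ring
      rw [hsq, sub_nonneg, div_le_iff₀ (by positivity)]
      linarith [h t]
  · obtain ⟨k, rfl⟩ : ∃ k, e1 = 2 * e0 * k := ⟨e1 / (2 * e0), by field_simp⟩
    obtain rfl : e2 = e0 * k ^ 2 := by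
      have := hE (-k)
      nlinarith
    have hroot : f0 * (-k) ^ 3 + f1 * (-k) ^ 2 + f2 * (-k) + f3 = 0 := by
      have := h (-k)
      have hz : e0 * (-k) ^ 2 + 2 * e0 * k * (-k) + e0 * k ^ 2 = 0 := by ring
      rw [hz] at this
      nlinarith
    obtain ⟨s, hs, rfl⟩ : ∃ s : ℝ, 0 < s ∧ e0 = s ^ 2 :=
      ⟨√e0, Real.sqrt_pos.2 hpos, (Real.sq_sqrt hpos.le).symm⟩
    obtain ⟨c0, c1, c2, hc⟩ : ∃ c0 c1 c2 : ℝ, ∀ t : ℝ, f0 * t ^ 3 + f1 * t ^ 2 + f2 * t + f3 =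
        2 * ((s * t + s * k) * (c0 * t ^ 2 + c1 * t + c2)) := by
      refine ⟨f0 / (2 * s), (f1 - k * f0) / (2 * s), (f2 - k * f1 + k ^ 2 * f0) / (2 * s),
        fun t => ?_⟩
      field_simp
      linear_combination hroot
    refine ⟨s, s * k, c0, c1, c2, fun t => ⟨by ring, hc t, ?_⟩⟩
    refine Continuous.nonneg_of_forall_ne (f := fun t => g0 * t ^ 4 + g1 * t ^ 3 + g2 * t ^ 2 +
      g3 * t + g4 - (c0 * t ^ 2 + c1 * t + c2) ^ 2) (by fun_prop) (-k) (fun t ht => ?_) t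
    have hne : t + k ≠ 0 := fun h0 => ht (by linarith)
    have ht := h t
    rw [hc t] at ht
    have hl : 0 < 4 * (s ^ 2 * (t + k) ^ 2) := by positivity
    refine (mul_nonneg_iff_of_pos_left hl).1 ?_
    linarith

/-- The dehomogenized decomposition when the coefficient of `y²` is degenerate. -/
theorem exists_sos_of_degenerate {e0 e1 e2 f0 f1 f2 f3 g0 g1 g2 g3 g4 : ℝ}
    (hdisc : 4 * e0 * e2 ≤ e1 ^ 2) (he0 : 0 ≤ e0) (hf0 : f0 ^ 2 ≤ 4 * e0 * g0)
    (hE : ∀ t : ℝ, 0 ≤ e0 * t ^ 2 + e1 * t + e2)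
    (hG : ∀ t : ℝ, 0 ≤ g0 * t ^ 4 + g1 * t ^ 3 + g2 * t ^ 2 + g3 * t + g4)
    (h : ∀ t : ℝ, (f0 * t ^ 3 + f1 * t ^ 2 + f2 * t + f3) ^ 2 ≤
      4 * (e0 * t ^ 2 + e1 * t + e2) * (g0 * t ^ 4 + g1 * t ^ 3 + g2 * t ^ 2 + g3 * t + g4)) :
    ∃ ξ0 ξ1 ξ2 s10 s11 s12 s20 s21 s22 l10 l11 l20 l21 : ℝ, ∀ t : ℝ,
      e0 * t ^ 2 + e1 * t + e2 = (l10 * t + l11) ^ 2 + (l20 * t + l21) ^ 2 ∧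
      f0 * t ^ 3 + f1 * t ^ 2 + f2 * t + f3 =
        2 * ((l10 * t + l11) * (s10 * t ^ 2 + s11 * t + s12) +
          (l20 * t + l21) * (s20 * t ^ 2 + s21 * t + s22)) ∧
      g0 * t ^ 4 + g1 * t ^ 3 + g2 * t ^ 2 + g3 * t + g4 =
        (ξ0 * t ^ 2 + ξ1 * t + ξ2) ^ 2 + (s10 * t ^ 2 + s11 * t + s12) ^ 2 +
          (s20 * t ^ 2 + s21 * t + s22) ^ 2 := by
  obtain ⟨l0, l1, c0, c1, c2, hc⟩ := exists_split_square_of_degenerate hdisc he0 hf0 hE hG h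
  obtain ⟨a0, a1, a2, b0, b1, b2, hab⟩ := exists_quartic_eq_sq_add_sq (g0 := g0 - c0 ^ 2)
    (g1 := g1 - 2 * c0 * c1) (g2 := g2 - 2 * c0 * c2 - c1 ^ 2) (g3 := g3 - 2 * c1 * c2)
    (g4 := g4 - c2 ^ 2) (fun t => by linarith [(hc t).2.2])
  refine ⟨a0, a1, a2, c0, c1, c2, b0, b1, b2, l0, l1, 0, 0, fun t => ⟨?_, ?_, ?_⟩⟩
  · linear_combination (hc t).1
  · linear_combination (hc t).2.1
  · linear_combination hab t

/-- A psd quartic form `Δ(x₁,x₂,y) = Δ₀(x₁,x₂)y² + Δ₁(x₁,x₂)y + Δ₂(x₁,x₂)`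
(with `Δ₀` a binary quadratic form, `Δ₁` a binary cubic form, `Δ₂` a binary quartic form)
can be written as `ξ² + (s₁ + l₁y)² + (s₂ + l₂y)²` with `ξ, s₁, s₂` binary quadratic
forms and `l₁, l₂` binary linear forms. -/
theorem psd_ternary_quartic_special_sos
    (e0 e1 e2 : ℝ) (f0 f1 f2 f3 : ℝ) (g0 g1 g2 g3 g4 : ℝ)
    (D0 : ℝ → ℝ → ℝ)
    (hD0 : ∀ x1 x2, D0 x1 x2 = e0 * x1 ^ 2 + e1 * (x1 * x2) + e2 * x2 ^ 2)
    (D1 : ℝ → ℝ → ℝ)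
    (hD1 : ∀ x1 x2, D1 x1 x2 =
      f0 * x1 ^ 3 + f1 * (x1 ^ 2 * x2) + f2 * (x1 * x2 ^ 2) + f3 * x2 ^ 3)
    (D2 : ℝ → ℝ → ℝ)
    (hD2 : ∀ x1 x2, D2 x1 x2 =
      g0 * x1 ^ 4 + g1 * (x1 ^ 3 * x2) + g2 * (x1 ^ 2 * x2 ^ 2)
        + g3 * (x1 * x2 ^ 3) + g4 * x2 ^ 4)
    (Δ : ℝ → ℝ → ℝ → ℝ)
    (hΔ : ∀ x1 x2 y, Δ x1 x2 y = D0 x1 x2 * y ^ 2 + D1 x1 x2 * y + D2 x1 x2)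
    (hpsd : ∀ x1 x2 y, 0 ≤ Δ x1 x2 y) :
    ∃ (ξ0 ξ1 ξ2 s10 s11 s12 s20 s21 s22 l10 l11 l20 l21 : ℝ),
      ∀ x1 x2 y,
        Δ x1 x2 y =
          (ξ0 * x1 ^ 2 + ξ1 * (x1 * x2) + ξ2 * x2 ^ 2) ^ 2
            + ((s10 * x1 ^ 2 + s11 * (x1 * x2) + s12 * x2 ^ 2)
                + (l10 * x1 + l11 * x2) * y) ^ 2
            + ((s20 * x1 ^ 2 + s21 * (x1 * x2) + s22 * x2 ^ 2)
                + (l20 * x1 + l21 * x2) * y) ^ 2 := by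
  have hquad : ∀ x1 x2, 0 ≤ D0 x1 x2 ∧ D1 x1 x2 ^ 2 ≤ 4 * D0 x1 x2 * D2 x1 x2 := fun x1 x2 =>
    leading_nonneg_and_sq_le_of_quadratic_nonneg fun y => by
      simpa only [hΔ] using hpsd x1 x2 y
  have he0 : 0 ≤ e0 := by simpa [hD0] using (hquad 1 0).1
  have hf0 : f0 ^ 2 ≤ 4 * e0 * g0 := by simpa [hD0, hD1, hD2] using (hquad 1 0).2
  have hE : ∀ t : ℝ, 0 ≤ e0 * t ^ 2 + e1 * t + e2 := fun t => by
    simpa [hD0] using (hquad t 1).1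
  have hG : ∀ t : ℝ, 0 ≤ g0 * t ^ 4 + g1 * t ^ 3 + g2 * t ^ 2 + g3 * t + g4 := fun t => by
    simpa [hΔ, hD2] using hpsd t 1 0
  have hEFG : ∀ t : ℝ, (f0 * t ^ 3 + f1 * t ^ 2 + f2 * t + f3) ^ 2 ≤
      4 * (e0 * t ^ 2 + e1 * t + e2) *
        (g0 * t ^ 4 + g1 * t ^ 3 + g2 * t ^ 2 + g3 * t + g4) := fun t => by
    simpa [hD0, hD1, hD2] using (hquad t 1).2
  obtain ⟨ξ0, ξ1, ξ2, s10, s11, s12, s20, s21, s22, l10, l11, l20, l21, h⟩ :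
      ∃ ξ0 ξ1 ξ2 s10 s11 s12 s20 s21 s22 l10 l11 l20 l21 : ℝ, ∀ t : ℝ,
        e0 * t ^ 2 + e1 * t + e2 = (l10 * t + l11) ^ 2 + (l20 * t + l21) ^ 2 ∧
        f0 * t ^ 3 + f1 * t ^ 2 + f2 * t + f3 =
          2 * ((l10 * t + l11) * (s10 * t ^ 2 + s11 * t + s12) +
            (l20 * t + l21) * (s20 * t ^ 2 + s21 * t + s22)) ∧
        g0 * t ^ 4 + g1 * t ^ 3 + g2 * t ^ 2 + g3 * t + g4 =
          (ξ0 * t ^ 2 + ξ1 * t + ξ2) ^ 2 + (s10 * t ^ 2 + s11 * t + s12) ^ 2 +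
            (s20 * t ^ 2 + s21 * t + s22) ^ 2 := by
    rcases le_or_gt (4 * e0 * e2) (e1 ^ 2) with hdisc | hdisc
    · exact exists_sos_of_degenerate hdisc he0 hf0 hE hG hEFG
    · have hpos : 0 < e0 := he0.lt_of_ne fun h0 => by
        rw [← h0] at hdisc
        linarith [sq_nonneg e1]
      exact exists_sos_of_definite hpos hdisc hEFG
  refine ⟨ξ0, ξ1, ξ2, s10, s11, s12, s20, s21, s22, l10, l11, l20, l21, fun x z y => ?_⟩
  rw [hΔ]
  -- Lagrange interpolation of binary forms at the points `(t, 1)` with `t = 0, 1, -1, 2, -2`.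
  have h₀ : D0 x z = (l10 * x + l11 * z) ^ 2 + (l20 * x + l21 * z) ^ 2 := by
    rw [hD0]
    linear_combination (z ^ 2 - x ^ 2) * (h 0).1 + x * (x + z) / 2 * (h 1).1 +
      x * (x - z) / 2 * (h (-1)).1
  have h₁ : D1 x z =
      2 * ((l10 * x + l11 * z) * (s10 * x ^ 2 + s11 * (x * z) + s12 * z ^ 2) +
        (l20 * x + l21 * z) * (s20 * x ^ 2 + s21 * (x * z) + s22 * z ^ 2)) := by
    rw [hD1]
    linear_combination (x ^ 2 - z ^ 2) * (x - 2 * z) / 2 * (h 0).2.1 -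
      x * (x + z) * (x - 2 * z) / 2 * (h 1).2.1 - x * (x - z) * (x - 2 * z) / 6 * (h (-1)).2.1 +
      x * (x ^ 2 - z ^ 2) / 6 * (h 2).2.1
  have h₂ : D2 x z = (ξ0 * x ^ 2 + ξ1 * (x * z) + ξ2 * z ^ 2) ^ 2 +
      (s10 * x ^ 2 + s11 * (x * z) + s12 * z ^ 2) ^ 2 +
        (s20 * x ^ 2 + s21 * (x * z) + s22 * z ^ 2) ^ 2 := by
    rw [hD2]
    linear_combination (x ^ 2 - z ^ 2) * (x ^ 2 - 4 * z ^ 2) / 4 * (h 0).2.2 -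
      x * (x + z) * (x ^ 2 - 4 * z ^ 2) / 6 * (h 1).2.2 -
      x * (x - z) * (x ^ 2 - 4 * z ^ 2) / 6 * (h (-1)).2.2 +
      x * (x + 2 * z) * (x ^ 2 - z ^ 2) / 24 * (h 2).2.2 +
      x * (x - 2 * z) * (x ^ 2 - z ^ 2) / 24 * (h (-2)).2.2
  linear_combination y ^ 2 * h₀ + y * h₁ + h₂
end
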